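/- Let N ≥ 1 and let Ω ⊊ ℝ^N be a nonempty bounded convex open set. Then lim_{s→1⁻} limsup_{p→1⁺} 𝔥_{s,p}(Ω)/𝔥_{s,p}(ℍ^N_+) = 1/2. -/

import Mathlib

open MeasureTheory Metric Set Filter
open scoped ENNReal NNReal

/-- The `p`-th power of the Gagliardo `(s,p)`-seminorm of `u` on `A ⊆ ℝ^N`,
valued in `[0,∞]`. -/
noncomputable def gagliardo (N : ℕ) (s p : ℝ) (A : Set (EuclideanSpace ℝ (Fin N)))
    (u : EuclideanSpace ℝ (Fin N) → ℝ) : ℝ≥0∞ :=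
  ∫⁻ x in A, ∫⁻ y in A, ENNReal.ofReal (|u x - u y| ^ p / dist x y ^ ((N : ℝ) + s * p))

/-- The sharp fractional Hardy constant `𝔥_{s,p}(Ω)`, an element of `[0,∞]`. -/
noncomputable def hardyConst (N : ℕ) (s p : ℝ) (Ω : Set (EuclideanSpace ℝ (Fin N))) : ℝ≥0∞ :=
  sInf { c : ℝ≥0∞ | ∃ u : EuclideanSpace ℝ (Fin N) → ℝ,
    ContDiff ℝ (⊤ : ℕ∞) u ∧ HasCompactSupport u ∧ tsupport u ⊆ Ω ∧
    (∫ x in Ω, |u x| ^ p / Metric.infDist x (frontier Ω) ^ (s * p)) = 1 ∧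
    c = gagliardo N s p Set.univ u }

/-- The half-space `ℍ^N₊ = (0,∞) × ℝ^{N-1}`. -/
noncomputable def halfSpace (N : ℕ) (hN : 0 < N) : Set (EuclideanSpace ℝ (Fin N)) :=
  {x | 0 < x ⟨0, hN⟩}

noncomputable def hrKer (N : ℕ) (σ : ℝ) (z : EuclideanSpace ℝ (Fin N)) : ℝ≥0∞ :=
  ENNReal.ofReal (1 / ‖z‖ ^ ((N : ℝ) + σ))

noncomputable def hrE (N : ℕ) (hN : 0 < N) : EuclideanSpace ℝ (Fin N) :=
  EuclideanSpace.single ⟨0, hN⟩ (1 : ℝ)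

noncomputable def hrK (N : ℕ) (hN : 0 < N) (σ : ℝ) : ℝ≥0∞ :=
  ∫⁻ z in {z : EuclideanSpace ℝ (Fin N) | 1 < inner ℝ (hrE N hN) z}, hrKer N σ z

lemma hrE_norm (N : ℕ) (hN : 0 < N) : ‖hrE N hN‖ = 1 := by
  simp [hrE]

lemma hrE_inner (N : ℕ) (hN : 0 < N) (z : EuclideanSpace ℝ (Fin N)) :
    inner ℝ (hrE N hN) z = z ⟨0, hN⟩ := by
  simp [hrE, EuclideanSpace.inner_single_left]

lemma hrKer_meas (N : ℕ) (σ : ℝ) : Measurable (hrKer N σ) := by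
  unfold hrKer; fun_prop

lemma hrKer_neg (N : ℕ) (σ : ℝ) (z) : hrKer N σ (-z) = hrKer N σ z := by
  simp [hrKer]

lemma hrHS_meas {N : ℕ} (v : EuclideanSpace ℝ (Fin N)) (r : ℝ) :
    MeasurableSet {z : EuclideanSpace ℝ (Fin N) | r < inner ℝ v z} :=
  (isOpen_lt continuous_const (by fun_prop)).measurableSet

lemma hrKer_rot (N : ℕ) (hN : 0 < N) (σ r : ℝ) (v : EuclideanSpace ℝ (Fin N)) (hv : ‖v‖ = 1) :
    ∫⁻ z in {z | r < inner ℝ v z}, hrKer N σ z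
      = ∫⁻ z in {z | r < inner ℝ (hrE N hN) z}, hrKer N σ z := by
  set T := Submodule.reflection (Submodule.span ℝ {hrE N hN - v})ᗮ with hT
  have hTv : T (hrE N hN) = v := Submodule.reflection_sub (by rw [hv, hrE_norm])
  have hmp := T.measurePreserving
  rw [← hmp.setLIntegral_comp_preimage (hrHS_meas v r) (hrKer_meas N σ)]
  have : (T ⁻¹' {z | r < inner ℝ v z}) = {z | r < inner ℝ (hrE N hN) z} := by
    ext z
    simp only [mem_preimage, mem_ofPred_eq]
    rw [← hTv, LinearIsometryEquiv.inner_map_map]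
  rw [this]
  simp [hrKer]

lemma hrKer_scale (N : ℕ) (σ r : ℝ) (hr : 0 < r) (v : EuclideanSpace ℝ (Fin N)) :
    ∫⁻ z in {z | r < inner ℝ v z}, hrKer N σ z
      = ENNReal.ofReal (r ^ (-σ)) * ∫⁻ z in {z | 1 < inner ℝ v z}, hrKer N σ z := by
  have hmap := Measure.map_addHaar_smul (volume : Measure (EuclideanSpace ℝ (Fin N))) hr.ne'
  have hm : Measurable (fun z : EuclideanSpace ℝ (Fin N) => r • z) := measurable_const_smul r
  have h1 : ∫⁻ z in {z | r < inner ℝ v z}, hrKer N σ z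
      ∂(Measure.map (r • ·) (volume : Measure (EuclideanSpace ℝ (Fin N))))
      = ∫⁻ z in {z | 1 < inner ℝ v z}, hrKer N σ (r • z) := by
    rw [setLIntegral_map (hrHS_meas v r) (hrKer_meas N σ) hm]
    congr 1
    congr 1
    ext z
    simp only [mem_preimage, mem_ofPred_eq, inner_smul_right]
    constructor
    · intro h; nlinarith
    · intro h; nlinarith
  rw [hmap, Measure.restrict_smul, lintegral_smul_measure] at h1
  have h2 : ∀ z : EuclideanSpace ℝ (Fin N), hrKer N σ (r • z)
      = ENNReal.ofReal (r ^ (-((N : ℝ) + σ))) * hrKer N σ z := by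
    intro z
    unfold hrKer
    rw [← ENNReal.ofReal_mul (by positivity), norm_smul, Real.norm_of_nonneg hr.le,
      Real.mul_rpow hr.le (norm_nonneg _), Real.rpow_neg hr.le]
    congr 1
    field_simp
  simp_rw [h2] at h1
  rw [lintegral_const_mul _ (hrKer_meas N σ), smul_eq_mul, finrank_euclideanSpace_fin,
    abs_of_nonneg (by positivity)] at h1
  have h3 : ENNReal.ofReal (r ^ N) * ENNReal.ofReal ((r ^ N)⁻¹) = 1 := by
    rw [← ENNReal.ofReal_mul (by positivity), mul_inv_cancel₀ (by positivity), ENNReal.ofReal_one]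
  calc _ = ENNReal.ofReal (r ^ N) * (ENNReal.ofReal ((r ^ N)⁻¹) *
        ∫⁻ z in {z | r < inner ℝ v z}, hrKer N σ z) := by rw [← mul_assoc, h3, one_mul]
    _ = _ := by
      rw [h1, ← mul_assoc, ← ENNReal.ofReal_mul (by positivity)]
      congr 2
      rw [← Real.rpow_natCast, ← Real.rpow_add hr]
      congr 1; ring

lemma hrKer_hs (N : ℕ) (hN : 0 < N) (σ r : ℝ) (hr : 0 < r) (v : EuclideanSpace ℝ (Fin N))
    (hv : ‖v‖ = 1) :
    ∫⁻ z in {z | r < inner ℝ v z}, hrKer N σ z = ENNReal.ofReal (r ^ (-σ)) * hrK N hN σ := by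
  rw [hrKer_scale N σ r hr, hrKer_rot N hN σ 1 v hv, hrK]

lemma hrC_mono (N : ℕ) (σ τ : ℝ) (h : σ ≤ τ) :
    ∫⁻ z in {z : EuclideanSpace ℝ (Fin N) | 1 ≤ ‖z‖}, hrKer N τ z ≤
    ∫⁻ z in {z : EuclideanSpace ℝ (Fin N) | 1 ≤ ‖z‖}, hrKer N σ z := by
  apply setLIntegral_mono (hrKer_meas N σ)
  intro z hz
  simp only [mem_ofPred_eq] at hz
  unfold hrKer
  apply ENNReal.ofReal_le_ofReal
  apply one_div_le_one_div_of_le (by positivity)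
  exact Real.rpow_le_rpow_of_exponent_le hz (by linarith)

lemma hrC_fin (N : ℕ) (σ : ℝ) (h : 0 < σ) :
    ∫⁻ z in {z : EuclideanSpace ℝ (Fin N) | 1 ≤ ‖z‖}, hrKer N σ z < ∞ := by
  have hfin := finite_integral_one_add_norm (E := EuclideanSpace ℝ (Fin N)) (μ := volume)
    (r := (N : ℝ) + σ) (by rw [finrank_euclideanSpace_fin]; linarith)
  have hle : ∫⁻ z in {z : EuclideanSpace ℝ (Fin N) | 1 ≤ ‖z‖}, hrKer N σ z ≤
      ∫⁻ z : EuclideanSpace ℝ (Fin N), ENNReal.ofReal (2 ^ ((N : ℝ) + σ)) *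
        ENNReal.ofReal ((1 + ‖z‖) ^ (-((N : ℝ) + σ))) := by
    refine le_trans (setLIntegral_mono (g := fun z => ENNReal.ofReal (2 ^ ((N : ℝ) + σ)) *
        ENNReal.ofReal ((1 + ‖z‖) ^ (-((N : ℝ) + σ)))) (by fun_prop) ?_) (setLIntegral_le_lintegral _ _)
    intro z hz
    simp only [mem_ofPred_eq] at hz
    unfold hrKer
    rw [← ENNReal.ofReal_mul (by positivity)]
    apply ENNReal.ofReal_le_ofReal
    rw [Real.rpow_neg (by positivity), ← div_eq_mul_inv, div_le_div_iff₀ (by positivity) (by positivity),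
      one_mul, ← Real.mul_rpow (by positivity) (by positivity)]
    exact Real.rpow_le_rpow (by positivity) (by linarith) (by positivity)
  refine lt_of_le_of_lt hle ?_
  rw [lintegral_const_mul _ (by fun_prop)]
  exact ENNReal.mul_lt_top ENNReal.ofReal_lt_top hfin

lemma hrHS_sub (N : ℕ) (hN : 0 < N) (z : EuclideanSpace ℝ (Fin N)) (h : 1 < inner ℝ (hrE N hN) z) :
    1 ≤ ‖z‖ := by
  have := real_inner_le_norm (hrE N hN) z
  rw [hrE_norm, one_mul] at this
  linarith

lemma hrK_fin (N : ℕ) (hN : 0 < N) (σ : ℝ) (h : 0 < σ) : hrK N hN σ < ∞ :=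
  lt_of_le_of_lt (lintegral_mono_set (fun z hz => hrHS_sub N hN z hz)) (hrC_fin N σ h)

lemma hrK_anti (N : ℕ) (hN : 0 < N) (σ τ : ℝ) (h : σ ≤ τ) : hrK N hN τ ≤ hrK N hN σ := by
  apply setLIntegral_mono (hrKer_meas N σ)
  intro z hz
  have hz := hrHS_sub N hN z hz
  unfold hrKer
  apply ENNReal.ofReal_le_ofReal
  apply one_div_le_one_div_of_le (by positivity)
  exact Real.rpow_le_rpow_of_exponent_le hz (by linarith)

lemma hrK_pos (N : ℕ) (hN : 0 < N) (σ : ℝ) : 0 < hrK N hN σ := by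
  unfold hrK
  rw [setLIntegral_pos_iff (hrKer_meas N σ)]
  have : Function.support (hrKer N σ) ∩ {z | 1 < inner ℝ (hrE N hN) z}
      = {z | 1 < inner ℝ (hrE N hN) z} := by
    apply inter_eq_right.2
    intro z hz
    have hz := hrHS_sub N hN z hz
    simp only [Function.mem_support, hrKer, ne_eq, ENNReal.ofReal_eq_zero, not_le]
    positivity
  rw [this]
  apply IsOpen.measure_pos volume (isOpen_lt continuous_const (by fun_prop))
  refine ⟨(2 : ℝ) • hrE N hN, ?_⟩
  simp [inner_smul_right, hrE_norm]

lemma hr_tau (σ : ℝ) (h1 : σ < 1) (t : ℝ) (ht : 0 < t) :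
    ∫⁻ τ in Ioc (0 : ℝ) t, ENNReal.ofReal (τ ^ (-σ)) = ENNReal.ofReal (t ^ (1 - σ) / (1 - σ)) := by
  have hi : IntervalIntegrable (fun τ : ℝ => τ ^ (-σ)) volume 0 t :=
    intervalIntegral.intervalIntegrable_rpow' (by linarith)
  rw [← ofReal_integral_eq_lintegral_ofReal]
  · rw [← intervalIntegral.integral_of_le ht.le, integral_rpow (Or.inl (by linarith)),
      Real.zero_rpow (by linarith)]
    congr 1
    rw [sub_zero, neg_add_eq_sub]
  · exact (intervalIntegrable_iff_integrableOn_Ioc_of_le ht.le).1 hi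
  · filter_upwards [ae_restrict_mem measurableSet_Ioc] with τ hτ
    exact Real.rpow_nonneg hτ.1.le _

lemma hrKappa_unit (N : ℕ) (hN : 0 < N) (σ : ℝ) (h1 : σ < 1) (v : EuclideanSpace ℝ (Fin N))
    (hv : ‖v‖ = 1) :
    ∫⁻ z in ball (0 : EuclideanSpace ℝ (Fin N)) 1, ENNReal.ofReal |inner ℝ v z| * hrKer N σ z
      ≤ ENNReal.ofReal (2 / (1 - σ)) * hrK N hN σ := by
  have hS : MeasurableSet {q : EuclideanSpace ℝ (Fin N) × ℝ | q.2 < |inner ℝ v q.1|} :=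
    (isOpen_lt (by fun_prop) (by fun_prop)).measurableSet
  have step1 : ∀ z ∈ ball (0 : EuclideanSpace ℝ (Fin N)) 1,
      ENNReal.ofReal |inner ℝ v z| * hrKer N σ z ≤
      ∫⁻ τ in Ioc (0 : ℝ) 1, {q : EuclideanSpace ℝ (Fin N) × ℝ | q.2 < |inner ℝ v q.1|}.indicator
        (fun q => hrKer N σ q.1) (z, τ) := by
    intro z hz
    have hz1 : |inner ℝ v z| < 1 := by
      have := abs_real_inner_le_norm v z
      rw [hv, one_mul] at this
      have h2 : ‖z‖ < 1 := by simpa using hz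
      linarith
    have : ∫⁻ τ in Ioc (0 : ℝ) 1, {q : EuclideanSpace ℝ (Fin N) × ℝ | q.2 < |inner ℝ v q.1|}.indicator
        (fun q => hrKer N σ q.1) (z, τ) ≥ ∫⁻ τ in Ioo (0 : ℝ) |inner ℝ v z|, hrKer N σ z := by
      refine le_trans ?_ (lintegral_mono_set (s := Ioo (0 : ℝ) |inner ℝ v z|) ?_)
      · apply setLIntegral_mono' measurableSet_Ioo
        intro τ hτ
        rw [indicator_of_mem]
        exact hτ.2
      · intro τ hτ; exact ⟨hτ.1, by linarith [hτ.2]⟩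
    refine le_trans (le_of_eq ?_) this
    rw [setLIntegral_const, Real.volume_Ioo, sub_zero, mul_comm]
  have hmeas : Measurable ({q : EuclideanSpace ℝ (Fin N) × ℝ | q.2 < |inner ℝ v q.1|}.indicator
        (fun q => hrKer N σ q.1)) := ((hrKer_meas N σ).comp measurable_fst).indicator hS
  calc _ ≤ ∫⁻ z, ∫⁻ τ in Ioc (0 : ℝ) 1,
        {q : EuclideanSpace ℝ (Fin N) × ℝ | q.2 < |inner ℝ v q.1|}.indicator
        (fun q => hrKer N σ q.1) (z, τ) :=
        le_trans (setLIntegral_mono' measurableSet_ball step1) (setLIntegral_le_lintegral _ _)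
    _ = ∫⁻ τ in Ioc (0 : ℝ) 1, ∫⁻ z,
        {q : EuclideanSpace ℝ (Fin N) × ℝ | q.2 < |inner ℝ v q.1|}.indicator
        (fun q => hrKer N σ q.1) (z, τ) := by
        rw [lintegral_lintegral_swap]
        exact hmeas.aemeasurable
    _ ≤ ∫⁻ τ in Ioc (0 : ℝ) 1, 2 * hrK N hN σ * ENNReal.ofReal (τ ^ (-σ)) := by
        apply setLIntegral_mono' measurableSet_Ioc
        intro τ hτ
        have : ∀ z, {q : EuclideanSpace ℝ (Fin N) × ℝ | q.2 < |inner ℝ v q.1|}.indicator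
          (fun q => hrKer N σ q.1) (z, τ) ≤ {z | τ < inner ℝ v z}.indicator (hrKer N σ) z
          + {z | τ < inner ℝ (-v) z}.indicator (hrKer N σ) z := by
          intro z
          by_cases h : τ < |inner ℝ v z|
          · rw [indicator_of_mem (by exact h)]
            rcases lt_abs.1 h with h | h
            · rw [indicator_of_mem (by exact h)]; exact le_self_add
            · rw [indicator_of_mem (s := {z | τ < inner ℝ (-v) z})]
              · exact le_add_self
              · simpa [inner_neg_left] using h
          · rw [indicator_of_notMem (by exact h)]; exact zero_le
        refine le_trans (lintegral_mono this) ?_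
        rw [lintegral_add_left ((hrKer_meas N σ).indicator (hrHS_meas _ _)),
          lintegral_indicator (hrHS_meas _ _), lintegral_indicator (hrHS_meas _ _),
          hrKer_hs N hN σ τ hτ.1 v hv, hrKer_hs N hN σ τ hτ.1 (-v) (by rwa [norm_neg])]
        apply le_of_eq; ring
    _ = _ := by
        rw [lintegral_const_mul _ (by fun_prop), hr_tau σ h1 1 one_pos, Real.one_rpow]
        rw [mul_comm 2, mul_assoc, mul_comm]
        congr 1
        rw [← ENNReal.ofReal_ofNat, ← ENNReal.ofReal_mul (by norm_num)]
        congr 1; ring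

lemma hrKappa (N : ℕ) (hN : 0 < N) (σ : ℝ) (h1 : σ < 1) (l : EuclideanSpace ℝ (Fin N) →L[ℝ] ℝ) :
    ∫⁻ z in ball (0 : EuclideanSpace ℝ (Fin N)) 1, ENNReal.ofReal |l z| * hrKer N σ z
      ≤ ENNReal.ofReal ‖l‖ * (ENNReal.ofReal (2 / (1 - σ)) * hrK N hN σ) := by
  set w := (InnerProductSpace.toDual ℝ (EuclideanSpace ℝ (Fin N))).symm l with hw
  have hl : ∀ z, l z = inner ℝ w z := fun z => by simp [hw]
  have hn : ‖l‖ = ‖w‖ := by simp [hw]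
  by_cases h0 : w = 0
  · simp [hl, h0]
  have hwn : 0 < ‖w‖ := norm_pos_iff.2 h0
  have := hrKappa_unit N hN σ h1 (‖w‖⁻¹ • w) (by
    rw [norm_smul, norm_inv, norm_norm, inv_mul_cancel₀ hwn.ne'])
  calc _ = ∫⁻ z in ball (0 : EuclideanSpace ℝ (Fin N)) 1, ENNReal.ofReal ‖w‖ *
        (ENNReal.ofReal |inner ℝ (‖w‖⁻¹ • w) z| * hrKer N σ z) := by
        congr 1; ext z
        rw [← mul_assoc, ← ENNReal.ofReal_mul hwn.le, hl, inner_smul_left]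
        simp only [map_inv₀, conj_trivial, abs_mul, abs_inv, abs_norm]
        rw [mul_inv_cancel_left₀ hwn.ne']
    _ ≤ _ := by
        rw [lintegral_const_mul _ (by have := hrKer_meas N σ; fun_prop), hn]
        gcongr

lemma hr_gag (N : ℕ) (s p : ℝ) (u : EuclideanSpace ℝ (Fin N) → ℝ) :
    gagliardo N s p univ u =
      ∫⁻ x, ∫⁻ y, ENNReal.ofReal (|u x - u y| ^ p) * hrKer N (s * p) (x - y) := by
  unfold gagliardo hrKer
  simp only [Measure.restrict_univ]
  congr 1; ext x; congr 1; ext y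
  rw [← ENNReal.ofReal_mul (by positivity), dist_eq_norm, mul_one_div]

lemma hr_swap {α β : Type*} [MeasurableSpace α] [MeasurableSpace β] {μ : Measure α} {ν : Measure β}
    [SFinite μ] [SFinite ν] (A : Set α) (S : α → Set β)
    (hR : MeasurableSet {q : α × β | q.1 ∈ A ∧ q.2 ∈ S q.1})
    (hA : MeasurableSet A) (f : α → β → ℝ≥0∞) (hf : Measurable (Function.uncurry f)) :
    ∫⁻ x in A, ∫⁻ y in S x, f x y ∂ν ∂μ = ∫⁻ y, ∫⁻ x in {x | x ∈ A ∧ y ∈ S x}, f x y ∂μ ∂ν := by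
  have hS : ∀ x ∈ A, MeasurableSet (S x) := by
    intro x hx
    have := measurable_prodMk_left (x := x) hR
    simpa [preimage, hx] using this
  have hT : ∀ y, MeasurableSet {x | x ∈ A ∧ y ∈ S x} := by
    intro y
    exact measurable_prodMk_right (y := y) hR
  have hm := hf.indicator hR
  calc _ = ∫⁻ x, ∫⁻ y, {q : α × β | q.1 ∈ A ∧ q.2 ∈ S q.1}.indicator (Function.uncurry f) (x, y) ∂ν ∂μ := by
        rw [← lintegral_indicator hA]
        congr 1; ext x
        by_cases hx : x ∈ A
        · rw [indicator_of_mem hx, ← lintegral_indicator (hS x hx)]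
          congr 1; ext y
          by_cases hy : y ∈ S x
          · simp [indicator, hx, hy, Function.uncurry]
          · simp [indicator, hy]
        · simp [indicator, hx]
    _ = ∫⁻ y, ∫⁻ x, {q : α × β | q.1 ∈ A ∧ q.2 ∈ S q.1}.indicator (Function.uncurry f) (x, y) ∂μ ∂ν :=
        lintegral_lintegral_swap hm.aemeasurable
    _ = _ := by
        congr 1; ext y
        rw [← lintegral_indicator (hT y)]
        rfl

lemma hr_sym {α : Type*} [MeasurableSpace α] {μ : Measure α}
    [SFinite μ] (A : Set α) (S : α → Set α)
    (hR : MeasurableSet {q : α × α | q.1 ∈ A ∧ q.2 ∈ S q.1})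
    (hA : MeasurableSet A) (f : α → α → ℝ≥0∞) (hf : Measurable (Function.uncurry f))
    (hsym : ∀ x y, f x y = f y x)
    (hanti : ∀ x y, x ∈ A → y ∈ S x → y ∈ A → x ∈ S y → False) :
    2 * ∫⁻ x in A, ∫⁻ y in S x, f x y ∂μ ∂μ ≤ ∫⁻ x, ∫⁻ y, f x y ∂μ ∂μ := by
  have hS : ∀ x ∈ A, MeasurableSet (S x) := by
    intro x hx
    have := measurable_prodMk_left (x := x) hR
    simpa [preimage, hx] using this
  have hT : ∀ y, MeasurableSet {x | x ∈ A ∧ y ∈ S x} := by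
    intro y
    exact measurable_prodMk_right (y := y) hR
  have hm := hf.indicator hR
  have e1 : ∫⁻ x in A, ∫⁻ y in S x, f x y ∂μ ∂μ
      = ∫⁻ x, ∫⁻ y, {q : α × α | q.1 ∈ A ∧ q.2 ∈ S q.1}.indicator (Function.uncurry f) (x, y) ∂μ ∂μ := by
    rw [← lintegral_indicator hA]
    congr 1; ext x
    by_cases hx : x ∈ A
    · rw [indicator_of_mem hx, ← lintegral_indicator (hS x hx)]
      congr 1; ext y
      by_cases hy : y ∈ S x
      · simp [indicator, hx, hy, Function.uncurry]
      · simp [indicator, hy]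
    · simp [indicator, hx]
  have e2 : ∫⁻ x in A, ∫⁻ y in S x, f x y ∂μ ∂μ
      = ∫⁻ x, ∫⁻ y, {q : α × α | q.1 ∈ A ∧ q.2 ∈ S q.1}.indicator (Function.uncurry f) (y, x) ∂μ ∂μ := by
    rw [e1]; exact lintegral_lintegral_swap hm.aemeasurable
  rw [two_mul]
  nth_rewrite 1 [e1]
  rw [e2, ← lintegral_add_left hm.lintegral_prod_right']
  apply lintegral_mono
  intro x
  dsimp only
  have hmx : Measurable (fun y => {q : α × α | q.1 ∈ A ∧ q.2 ∈ S q.1}.indicator (Function.uncurry f) (x, y)) :=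
    hm.comp measurable_prodMk_left
  rw [← lintegral_add_left hmx]
  apply lintegral_mono
  intro y
  by_cases h1 : x ∈ A ∧ y ∈ S x
  · have h2 : ¬ (y ∈ A ∧ x ∈ S y) := fun h => hanti x y h1.1 h1.2 h.1 h.2
    simp [indicator, h1, h2, Function.uncurry]
  · by_cases h2 : y ∈ A ∧ x ∈ S y
    · simp [indicator, h1, h2, Function.uncurry, hsym y x]
    · simp [indicator, h1, h2]

lemma hrKer_trans (N : ℕ) (hN : 0 < N) (σ r : ℝ) (hr : 0 < r) (v x : EuclideanSpace ℝ (Fin N))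
    (hv : ‖v‖ = 1) :
    ∫⁻ y in {y | r < inner ℝ v (y - x)}, hrKer N σ (x - y)
      = ENNReal.ofReal (r ^ (-σ)) * hrK N hN σ := by
  have hms : MeasurableSet {y | r < inner ℝ v (y - x)} :=
    (isOpen_lt continuous_const (by fun_prop)).measurableSet
  rw [← hrKer_hs N hN σ r hr v hv, ← lintegral_indicator hms, ← lintegral_indicator (hrHS_meas v r),
    ← lintegral_add_right_eq_self _ x]
  congr 1; ext z
  simp only [indicator, mem_ofPred_eq, add_sub_cancel_right, sub_add_cancel_right, hrKer_neg]

lemma hr_ball_sub {N : ℕ} {U : Set (EuclideanSpace ℝ (Fin N))} {x : EuclideanSpace ℝ (Fin N)}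
    (hU : IsOpen U) (hx : x ∈ U) : ball x (infDist x (frontier U)) ⊆ U := by
  intro y hy
  by_contra hyU
  have hpos : 0 < infDist x (frontier U) := pos_of_mem_ball hy
  have hc : IsPreconnected (ball x (infDist x (frontier U))) := (convex_ball _ _).isPreconnected
  have hnf : ∀ z ∈ ball x (infDist x (frontier U)), z ∉ frontier U := by
    intro z hz hzf
    have := infDist_le_dist_of_mem (x := x) hzf
    rw [mem_ball, dist_comm] at hz
    linarith
  have hcl : ∀ z ∈ ball x (infDist x (frontier U)), z ∉ U → z ∈ (closure U)ᶜ := by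
    intro z hz hzU hzc
    apply hnf z hz
    rw [hU.frontier_eq]
    exact ⟨hzc, hzU⟩
  obtain ⟨z, -, hz1, hz2⟩ := hc U (closure U)ᶜ hU isClosed_closure.isOpen_compl
    (fun z hz => by
      by_cases h : z ∈ U
      · exact Or.inl h
      · exact Or.inr (hcl z hz h))
    ⟨x, mem_ball_self hpos, hx⟩ ⟨y, hy, hcl y hy hyU⟩
  exact hz2 (subset_closure hz1)

lemma hr_infDist {N : ℕ} {U : Set (EuclideanSpace ℝ (Fin N))} {x : EuclideanSpace ℝ (Fin N)}
    (hU : IsOpen U) (hx : x ∈ U) (hf : (frontier U).Nonempty) :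
    infDist x (frontier U) = infDist x Uᶜ := by
  have hsub : frontier U ⊆ Uᶜ := by
    rw [hU.frontier_eq]; exact fun z hz => hz.2
  apply le_antisymm
  · rw [le_infDist (hf.mono hsub)]
    intro y hy
    by_contra h
    push Not at h
    exact hy (hr_ball_sub hU hx (by rwa [mem_ball, dist_comm]))
  · exact infDist_le_infDist_of_subset hsub hf

lemma hr_infDist_pos {N : ℕ} {U : Set (EuclideanSpace ℝ (Fin N))} {x : EuclideanSpace ℝ (Fin N)}
    (hU : IsOpen U) (hx : x ∈ U) (hf : (frontier U).Nonempty) :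
    0 < infDist x (frontier U) := by
  rw [← isClosed_frontier.notMem_iff_infDist_pos hf, hU.frontier_eq]
  exact fun h => h.2 hx

lemma hr_lint_one {α : Type*} [MeasurableSpace α] {μ : Measure α} {f : α → ℝ}
    (h0 : ∀ x, 0 ≤ f x) (h : ∫ x, f x ∂μ = 1) : ∫⁻ x, ENNReal.ofReal (f x) ∂μ = 1 := by
  have hi : Integrable f μ := by
    by_contra hc
    rw [integral_undef hc] at h
    norm_num at h
  rw [← ofReal_integral_eq_lintegral_ofReal hi (Eventually.of_forall h0), h, ENNReal.ofReal_one]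

lemma hr_support_fn {N : ℕ} {Ω : Set (EuclideanSpace ℝ (Fin N))} (hop : IsOpen Ω)
    (hconv : Convex ℝ Ω) (hf : (frontier Ω).Nonempty) {x : EuclideanSpace ℝ (Fin N)} (hx : x ∈ Ω) :
    ∃ v : EuclideanSpace ℝ (Fin N), ‖v‖ = 1 ∧
      ∀ y ∈ Ω, inner ℝ v (y - x) ≤ infDist x (frontier Ω) := by
  obtain ⟨x0, hx0, hd⟩ := isClosed_frontier.exists_infDist_eq_dist hf x
  have hx0' : x0 ∉ Ω := by rw [hop.frontier_eq] at hx0; exact hx0.2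
  obtain ⟨f, hff⟩ := geometric_hahn_banach_open_point hconv hop hx0'
  set w := (InnerProductSpace.toDual ℝ (EuclideanSpace ℝ (Fin N))).symm f with hw
  have hl : ∀ z, f z = inner ℝ w z := fun z => by simp [hw]
  have hw0 : w ≠ 0 := by
    intro h
    have := hff x hx
    simp [hl, h] at this
  have hwn : 0 < ‖w‖ := norm_pos_iff.2 hw0
  refine ⟨‖w‖⁻¹ • w, by rw [norm_smul, norm_inv, norm_norm, inv_mul_cancel₀ hwn.ne'], ?_⟩
  intro y hy
  rw [hd, inner_smul_left]
  simp only [conj_trivial]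
  rw [inv_mul_le_iff₀ hwn]
  have h1 := hff y hy
  rw [hl, hl] at h1
  have h2 : inner ℝ w (x0 - x) ≤ ‖w‖ * ‖x0 - x‖ := real_inner_le_norm _ _
  rw [dist_comm, dist_eq_norm]
  rw [inner_sub_right] at h2 ⊢
  linarith

lemma hr_L1 (N : ℕ) (hN : 0 < N) (s p : ℝ)
    (Ω : Set (EuclideanSpace ℝ (Fin N))) (hop : IsOpen Ω)
    (hconv : Convex ℝ Ω) (hf : (frontier Ω).Nonempty) :
    2 * hrK N hN (s * p) ≤ hardyConst N s p Ω := by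
  apply le_sInf
  rintro c ⟨u, hu, -, hsup, hint, rfl⟩
  have hW := hr_lint_one (fun x => by have := infDist_nonneg (x := x) (s := frontier Ω); positivity) hint
  have hum : Measurable u := hu.continuous.measurable
  have hkm := hrKer_meas N (s * p)
  rw [hr_gag]
  refine le_trans ?_ (hr_sym Ω (fun _ => Ωᶜ) ?_ hop.measurableSet _ ?_ ?_ ?_)
  · gcongr
    calc hrK N hN (s * p) = ∫⁻ x in Ω, ENNReal.ofReal (|u x| ^ p / infDist x (frontier Ω) ^ (s * p)) * hrK N hN (s * p) := by
          rw [lintegral_mul_const _ (by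
            have : Measurable (fun x => infDist x (frontier Ω)) := (continuous_infDist_pt _).measurable
            fun_prop), hW, one_mul]
      _ ≤ _ := by
          apply setLIntegral_mono' hop.measurableSet
          intro x hx
          have hd := hr_infDist_pos hop hx hf
          obtain ⟨v, hv, hvs⟩ := hr_support_fn hop hconv hf hx
          calc _ = ENNReal.ofReal (|u x| ^ p) * (∫⁻ y in {y | infDist x (frontier Ω) < inner ℝ v (y - x)}, hrKer N (s * p) (x - y)) := by
                rw [hrKer_trans N hN _ _ hd v x hv, ← mul_assoc, ← ENNReal.ofReal_mul (by positivity),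
                  Real.rpow_neg hd.le, div_eq_mul_inv]
            _ ≤ ENNReal.ofReal (|u x| ^ p) * (∫⁻ y in Ωᶜ, hrKer N (s * p) (x - y)) := by
                gcongr
                intro y hy
                by_contra hc
                exact absurd (hvs y (not_not.1 hc)) (not_le.2 hy)
            _ = ∫⁻ y in Ωᶜ, ENNReal.ofReal (|u x| ^ p) * hrKer N (s * p) (x - y) := by
                rw [lintegral_const_mul _ (by fun_prop)]
            _ ≤ _ := by
                apply setLIntegral_mono' hop.measurableSet.compl
                intro y hy
                have : u y = 0 := by
                  by_contra hc
                  exact hy (hsup (subset_tsupport _ hc))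
                rw [this, sub_zero]
  · exact (measurable_fst hop.measurableSet).inter (measurable_snd hop.measurableSet.compl)
  · unfold Function.uncurry; fun_prop
  · intro x y
    rw [abs_sub_comm, ← hrKer_neg, neg_sub]
  · intro x y hx hy hy'; exact absurd hy' hy

lemma hr_pow_ineq (a b p : ℝ) (hp : 1 ≤ p) :
    2 ^ (1 - p) * |a| ^ p ≤ |a - b| ^ p + |b| ^ p := by
  have h := NNReal.rpow_add_le_mul_rpow_add_rpow (Real.nnabs (a - b)) (Real.nnabs b) hp
  have h' : (|a - b| + |b|) ^ p ≤ 2 ^ (p - 1) * (|a - b| ^ p + |b| ^ p) := by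
    have := NNReal.coe_le_coe.2 h
    simpa using this
  have h2 : |a| ^ p ≤ (|a - b| + |b|) ^ p := by
    apply Real.rpow_le_rpow (abs_nonneg _) _ (by linarith)
    have := abs_add_le (a - b) b
    simpa using this
  have h3 : (2 : ℝ) ^ (1 - p) * 2 ^ (p - 1) = 1 := by
    rw [← Real.rpow_add two_pos]; simp
  have h4 : (0 : ℝ) < 2 ^ (1 - p) := by positivity
  calc 2 ^ (1 - p) * |a| ^ p ≤ 2 ^ (1 - p) * (2 ^ (p - 1) * (|a - b| ^ p + |b| ^ p)) := by
        gcongr; exact h2.trans h'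
    _ = _ := by rw [← mul_assoc, h3, one_mul]

lemma hrH_open (N : ℕ) (hN : 0 < N) : IsOpen (halfSpace N hN) :=
  isOpen_lt continuous_const (by fun_prop)

lemma hrH_frontier (N : ℕ) (hN : 0 < N) : (frontier (halfSpace N hN)).Nonempty := by
  rw [nonempty_frontier_iff]
  constructor
  · exact ⟨hrE N hN, by simp [halfSpace, hrE]⟩
  · intro h
    have : (0 : EuclideanSpace ℝ (Fin N)) ∈ halfSpace N hN := h ▸ mem_univ _
    simp [halfSpace] at this

lemma hrH_dist (N : ℕ) (hN : 0 < N) (x : EuclideanSpace ℝ (Fin N)) (hx : x ∈ halfSpace N hN) :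
    infDist x (frontier (halfSpace N hN)) = x ⟨0, hN⟩ := by
  rw [hr_infDist (hrH_open N hN) hx (hrH_frontier N hN)]
  have hx' : 0 < x ⟨0, hN⟩ := hx
  have hmem : x - (x ⟨0, hN⟩) • hrE N hN ∈ (halfSpace N hN)ᶜ := by
    simp [halfSpace, hrE]
  apply le_antisymm
  · refine le_trans (infDist_le_dist_of_mem hmem) ?_
    rw [dist_eq_norm, sub_sub_cancel, norm_smul, hrE_norm, mul_one, Real.norm_of_nonneg hx'.le]
  · rw [le_infDist ⟨_, hmem⟩]
    intro y hy
    have hy' : y ⟨0, hN⟩ ≤ 0 := not_lt.1 hy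
    have h1 := real_inner_le_norm (hrE N hN) (x - y)
    rw [hrE_inner, hrE_norm, one_mul, ← dist_eq_norm] at h1
    simp only [PiLp.sub_apply] at h1
    linarith

set_option maxHeartbeats 1000000 in
lemma hr_L2_core (N : ℕ) (hN : 0 < N) (s p ε : ℝ) (hp : 1 ≤ p) (hε : 0 < ε)
    (u : EuclideanSpace ℝ (Fin N) → ℝ) (hu : Measurable u)
    (hsup : ∀ y, y ∉ halfSpace N hN → u y = 0)
    (hW : ∫⁻ x in halfSpace N hN, ENNReal.ofReal (|u x| ^ p) * ENNReal.ofReal ((x ⟨0, hN⟩) ^ (-(s * p))) = 1) :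
    2 * (2 * hrK N hN (s * p) + ENNReal.ofReal (2 ^ (1 - p) * ε ^ (-(s * p))) * hrK N hN (s * p)) ≤
      gagliardo N s p univ u + 2 * (ENNReal.ofReal ((ε / (1 + ε)) ^ (-(s * p))) * hrK N hN (s * p)) := by
  set H := halfSpace N hN with hH
  set σ := s * p with hσ
  set k := hrK N hN σ with hk
  set i0 : Fin N := ⟨0, hN⟩
  have hHm : MeasurableSet H := (hrH_open N hN).measurableSet
  have hkm := hrKer_meas N σ
  set F : EuclideanSpace ℝ (Fin N) → EuclideanSpace ℝ (Fin N) → ℝ≥0∞ := fun x y =>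
    ENNReal.ofReal (|u x - u y| ^ p) * hrKer N σ (x - y) with hF
  set a : EuclideanSpace ℝ (Fin N) → ℝ≥0∞ := fun x => ENNReal.ofReal (|u x| ^ p) with ha
  have hFm : Measurable (Function.uncurry F) := by
    rw [hF]; unfold Function.uncurry; fun_prop
  have ham : Measurable a := by rw [ha]; fun_prop
  set S1 : Set (EuclideanSpace ℝ (Fin N)) := {y | y i0 < 0} with hS1
  set S2 : EuclideanSpace ℝ (Fin N) → Set (EuclideanSpace ℝ (Fin N)) :=
    fun x => {y | (1 + ε) * x i0 < y i0} with hS2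
  have hS1m : MeasurableSet S1 := (isOpen_lt (by fun_prop) (by fun_prop)).measurableSet
  have hS2m : ∀ x, MeasurableSet (S2 x) := fun x => (isOpen_lt (by fun_prop) (by fun_prop)).measurableSet
  have hR2 : MeasurableSet {q : EuclideanSpace ℝ (Fin N) × EuclideanSpace ℝ (Fin N) |
      q.1 ∈ H ∧ q.2 ∈ S2 q.1} :=
    (measurable_fst hHm).inter (isOpen_lt (by fun_prop) (by fun_prop)).measurableSet
  have hR : MeasurableSet {q : EuclideanSpace ℝ (Fin N) × EuclideanSpace ℝ (Fin N) |
      q.1 ∈ H ∧ q.2 ∈ S1 ∪ S2 q.1} := by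
    refine (measurable_fst hHm).inter (MeasurableSet.union (measurable_snd hS1m) ?_)
    exact (isOpen_lt (by fun_prop) (by fun_prop)).measurableSet
  have hg : 2 * ∫⁻ x in H, ∫⁻ y in S1 ∪ S2 x, F x y ≤ gagliardo N s p univ u := by
    rw [hr_gag]
    apply hr_sym H (fun x => S1 ∪ S2 x) hR hHm F hFm
    · intro x y
      simp only [hF]
      rw [abs_sub_comm, ← hrKer_neg, neg_sub]
    · intro x y hx hy hy' hx'
      have h1 : 0 < x i0 := hx
      have h2 : 0 < y i0 := hy'
      rcases hy with hy | hy <;> simp only [hS1, hS2, mem_ofPred_eq] at hy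
      · linarith
      · rcases hx' with hx' | hx' <;> simp only [hS1, hS2, mem_ofPred_eq] at hx'
        · linarith
        · nlinarith
  -- half-space integrals
  have hk1 : ∀ x : EuclideanSpace ℝ (Fin N), ∀ r > 0, ∫⁻ y in {y | x i0 + r < y i0}, hrKer N σ (x - y)
      = ENNReal.ofReal (r ^ (-σ)) * k := by
    intro x r hr
    rw [← hrKer_trans N hN σ r hr (hrE N hN) x (hrE_norm N hN)]
    congr 2
    ext y
    simp only [mem_ofPred_eq, hrE_inner, PiLp.sub_apply]
    exact lt_sub_iff_add_lt'.symm
  have hk2 : ∀ x : EuclideanSpace ℝ (Fin N), ∀ r > 0, ∫⁻ y in {y | y i0 < x i0 - r}, hrKer N σ (x - y)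
      = ENNReal.ofReal (r ^ (-σ)) * k := by
    intro x r hr
    rw [← hrKer_trans N hN σ r hr (-hrE N hN) x (by rw [norm_neg, hrE_norm N hN])]
    congr 2
    ext y
    simp only [mem_ofPred_eq, inner_neg_left, hrE_inner, PiLp.sub_apply]
    constructor <;> intro h <;> linarith
  have hA1 : ∀ x ∈ H, ∫⁻ y in S1, F x y = a x * ENNReal.ofReal (x i0 ^ (-σ)) * k := by
    intro x hx
    have h := hk2 x (x i0) hx
    rw [sub_self] at h
    rw [mul_assoc, ← h, ← lintegral_const_mul _ (by fun_prop)]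
    apply setLIntegral_congr_fun hS1m
    intro y hy
    have : u y = 0 := hsup y (fun h => lt_asymm (show y i0 < 0 from hy) h)
    simp only [hF, ha, this, sub_zero]
  have hA2 : ∀ x ∈ H, ENNReal.ofReal (2 ^ (1 - p) * ε ^ (-σ)) * k * (a x * ENNReal.ofReal (x i0 ^ (-σ)))
      ≤ (∫⁻ y in S2 x, F x y) + ∫⁻ y in S2 x, a y * hrKer N σ (x - y) := by
    intro x hx
    have hx' : 0 < x i0 := hx
    have h := hk1 x (ε * x i0) (by positivity)
    have hset : {y : EuclideanSpace ℝ (Fin N) | x i0 + ε * x i0 < y i0} = S2 x := by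
      ext y; simp only [hS2, mem_ofPred_eq]; rw [add_mul, one_mul]
    rw [hset] at h
    have hFx : Measurable (fun y => F x y) := by simp only [hF]; fun_prop
    rw [← lintegral_add_left hFx]
    calc _ = ENNReal.ofReal (2 ^ (1 - p)) * a x * ∫⁻ y in S2 x, hrKer N σ (x - y) := by
          rw [h, Real.mul_rpow hε.le hx'.le, ENNReal.ofReal_mul (by positivity), ENNReal.ofReal_mul (by positivity)]
          ring
      _ = ∫⁻ y in S2 x, ENNReal.ofReal (2 ^ (1 - p)) * a x * hrKer N σ (x - y) := by
          rw [lintegral_const_mul _ (by fun_prop)]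
      _ ≤ _ := by
          apply lintegral_mono
          intro y
          simp only [hF, ha]
          rw [← add_mul, ← ENNReal.ofReal_mul (by positivity), ← ENNReal.ofReal_add (by positivity) (by positivity)]
          gcongr
          exact hr_pow_ineq _ _ _ hp
  have hwm : Measurable (fun x : EuclideanSpace ℝ (Fin N) => a x * ENNReal.ofReal (x i0 ^ (-σ))) := by
    have : Measurable fun x : EuclideanSpace ℝ (Fin N) => x i0 := by fun_prop
    fun_prop
  set I := ∫⁻ x in H, ∫⁻ y in S2 x, F x y with hI
  set J := ∫⁻ x in H, ∫⁻ y in S2 x, a y * hrKer N σ (x - y) with hJ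
  have hIm : Measurable (fun x => ∫⁻ y in S2 x, F x y) := by
    have : ∀ x, ∫⁻ y in S2 x, F x y = ∫⁻ y, {q : EuclideanSpace ℝ (Fin N) × EuclideanSpace ℝ (Fin N) |
      q.2 ∈ S2 q.1}.indicator (Function.uncurry F) (x, y) := by
      intro x; rw [← lintegral_indicator (hS2m x)]; rfl
    simp_rw [this]
    have hm0 : MeasurableSet {q : EuclideanSpace ℝ (Fin N) × EuclideanSpace ℝ (Fin N) | q.2 ∈ S2 q.1} := by
      simp only [hS2, mem_ofPred_eq]
      exact (isOpen_lt (by fun_prop) (by fun_prop)).measurableSet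
    exact (hFm.indicator hm0).lintegral_prod_right'
  have e1 : k + I ≤ ∫⁻ x in H, ∫⁻ y in S1 ∪ S2 x, F x y := by
    calc k + I = (∫⁻ x in H, a x * ENNReal.ofReal (x i0 ^ (-σ)) * k) + I := by
          rw [lintegral_mul_const _ hwm, hW, one_mul]
      _ = ∫⁻ x in H, (a x * ENNReal.ofReal (x i0 ^ (-σ)) * k + ∫⁻ y in S2 x, F x y) := by
          rw [lintegral_add_left (by fun_prop)]
      _ ≤ _ := by
          apply setLIntegral_mono' hHm
          intro x hx
          rw [← hA1 x hx]
          rw [lintegral_union (hS2m x)]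
          rw [Set.disjoint_left]
          intro y hy1 hy2
          have hx' : 0 < x i0 := hx
          simp only [hS1, hS2, mem_ofPred_eq] at hy1 hy2
          nlinarith
  have e2 : ENNReal.ofReal (2 ^ (1 - p) * ε ^ (-σ)) * k ≤ I + J := by
    calc _ = ∫⁻ x in H, ENNReal.ofReal (2 ^ (1 - p) * ε ^ (-σ)) * k * (a x * ENNReal.ofReal (x i0 ^ (-σ))) := by
          rw [lintegral_const_mul _ hwm, hW, mul_one]
      _ ≤ ∫⁻ x in H, ((∫⁻ y in S2 x, F x y) + ∫⁻ y in S2 x, a y * hrKer N σ (x - y)) :=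
          setLIntegral_mono' hHm hA2
      _ = _ := by rw [lintegral_add_left hIm]
  have e3 : J + k ≤ ENNReal.ofReal ((ε / (1 + ε)) ^ (-σ)) * k := by
    have hJ' : J = ∫⁻ y in H, a y * ∫⁻ x in {x | x ∈ H ∧ y ∈ S2 x}, hrKer N σ (x - y) := by
      rw [hJ, hr_swap H S2 hR2 hHm _ (by unfold Function.uncurry; fun_prop), ← lintegral_indicator hHm]
      congr 1; ext y
      by_cases hy : y ∈ H
      · rw [indicator_of_mem hy, lintegral_const_mul _ (by fun_prop)]
      · rw [indicator_of_notMem hy]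
        have : a y = 0 := by
          simp only [ha, hsup y hy, abs_zero]
          rw [Real.zero_rpow (by linarith), ENNReal.ofReal_zero]
        simp [this]
    calc J + k = J + ∫⁻ x in H, a x * ENNReal.ofReal (x i0 ^ (-σ)) * k := by
          rw [lintegral_mul_const _ hwm, hW, one_mul]
      _ = ∫⁻ y in H, ((a y * ∫⁻ x in {x | x ∈ H ∧ y ∈ S2 x}, hrKer N σ (x - y)) +
            a y * ENNReal.ofReal (y i0 ^ (-σ)) * k) := by
          rw [hJ', lintegral_add_right _ (by fun_prop)]
      _ ≤ ∫⁻ y in H, ENNReal.ofReal ((ε / (1 + ε)) ^ (-σ)) * k * (a y * ENNReal.ofReal (y i0 ^ (-σ))) := by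
          apply setLIntegral_mono' hHm
          intro y hy
          have hy' : 0 < y i0 := hy
          have h0 := hk2 y (y i0) hy'
          rw [sub_self] at h0
          have hεp : 0 < ε / (1 + ε) := by positivity
          have h1 := hk2 y (ε / (1 + ε) * y i0) (by positivity)
          have hm1 : MeasurableSet {x | x ∈ H ∧ y ∈ S2 x} :=
            hHm.inter (isOpen_lt (by fun_prop) (by fun_prop)).measurableSet
          have h2 : (∫⁻ x in {x | x ∈ H ∧ y ∈ S2 x}, hrKer N σ (x - y)) + ENNReal.ofReal (y i0 ^ (-σ)) * k
              ≤ ENNReal.ofReal ((ε / (1 + ε) * y i0) ^ (-σ)) * k := by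
            rw [← h0, ← h1]
            have : ∀ x, hrKer N σ (x - y) = hrKer N σ (y - x) := fun x => by
              rw [← hrKer_neg, neg_sub]
            simp_rw [this]
            rw [← lintegral_union hS1m]
            · apply lintegral_mono_set
              have hq : y i0 - ε / (1 + ε) * y i0 = y i0 / (1 + ε) := by field_simp; ring
              rintro x (⟨hx1, hx2⟩ | hx) <;> simp only [mem_ofPred_eq, hq]
              · simp only [hS2, mem_ofPred_eq] at hx2
                rw [lt_div_iff₀ (by positivity)]; linarith
              · exact lt_trans hx (by positivity)
            · rw [Set.disjoint_left]
              rintro x ⟨hx1, -⟩ hx2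
              exact lt_asymm (show 0 < x i0 from hx1) hx2
          rw [mul_assoc, ← mul_add]
          calc _ ≤ a y * (ENNReal.ofReal ((ε / (1 + ε) * y i0) ^ (-σ)) * k) := by gcongr
            _ = _ := by
              rw [Real.mul_rpow hεp.le hy'.le, ENNReal.ofReal_mul (by positivity)]; ring
      _ = _ := by rw [lintegral_const_mul _ hwm, hW, mul_one]
  calc _ ≤ 2 * (2 * k + (I + J)) := by gcongr
    _ = 2 * (k + I) + 2 * (J + k) := by ring
    _ ≤ _ := by
      gcongr
      exact le_trans (by gcongr) hg

lemma hr_L2 (N : ℕ) (hN : 0 < N) (s p ε : ℝ) (hp : 1 ≤ p) (hε : 0 < ε) (hσ : 0 < s * p) (hσ1 : s * p < 1) :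
    ENNReal.ofReal (2 * (2 - ε ^ (1 - s * p) - ε ^ (-(s * p)) * (1 - 2 ^ (1 - p)))) * hrK N hN (s * p)
      ≤ hardyConst N s p (halfSpace N hN) := by
  apply le_sInf
  rintro c ⟨u, hu, -, hsup, hint, rfl⟩
  have hW := hr_lint_one (fun x => by
    have := infDist_nonneg (x := x) (s := frontier (halfSpace N hN)); positivity) hint
  have hcore := hr_L2_core N hN s p ε hp hε u hu.continuous.measurable (fun y hy => by
      by_contra hc
      exact hy (hsup (subset_tsupport _ hc))) (by
    rw [← hW]
    apply setLIntegral_congr_fun (hrH_open N hN).measurableSet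
    intro x hx
    have hx' : 0 < x ⟨0, hN⟩ := hx
    simp only
    rw [hrH_dist N hN x hx, ← ENNReal.ofReal_mul (by positivity), Real.rpow_neg hx'.le, div_eq_mul_inv])
  set σ := s * p
  have hkf := hrK_fin N hN σ hσ
  set k := hrK N hN σ
  have hB : (ε / (1 + ε)) ^ (-σ) ≤ ε ^ (-σ) + ε ^ (1 - σ) := by
    have h1 : (1 + ε) ^ σ ≤ 1 + σ * ε := rpow_one_add_le_one_add_mul_self (by linarith) hσ.le hσ1.le
    have h2 : (1 + ε) ^ σ ≤ 1 + ε := by nlinarith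
    rw [Real.div_rpow hε.le (by positivity), Real.rpow_neg (by positivity : (0:ℝ) ≤ 1 + ε), div_inv_eq_mul,
      sub_eq_add_neg, Real.rpow_add hε, Real.rpow_one]
    have h3 : 0 < ε ^ (-σ) := by positivity
    nlinarith
  by_cases hgt : gagliardo N s p univ u = ∞
  · rw [hgt]; exact le_top
  lift gagliardo N s p univ u to ℝ≥0 using hgt with g
  lift k to ℝ≥0 using hkf.ne with k'
  rw [← ENNReal.toReal_le_toReal (by finiteness) (by finiteness)] at hcore
  have hpos : (0:ℝ) ≤ 2 ^ (1 - p) * ε ^ (-σ) := by positivity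
  have hpos2 : (0:ℝ) ≤ (ε / (1 + ε)) ^ (-σ) := by positivity
  rw [ENNReal.toReal_mul, ENNReal.toReal_add (by finiteness) (by finiteness), ENNReal.toReal_mul,
    ENNReal.toReal_mul, ENNReal.toReal_add (by finiteness) (by finiteness), ENNReal.toReal_mul,
    ENNReal.toReal_mul, ENNReal.toReal_ofReal hpos, ENNReal.toReal_ofReal hpos2] at hcore
  simp only [ENNReal.toReal_ofNat, ENNReal.coe_toReal] at hcore
  have hk0 : (0:ℝ) ≤ k' := k'.2
  have : (2 * (2 - ε ^ (1 - σ) - ε ^ (-σ) * (1 - 2 ^ (1 - p)))) * (k' : ℝ) ≤ g := by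
    nlinarith [mul_le_mul_of_nonneg_right hB hk0]
  calc _ = ENNReal.ofReal (2 * (2 - ε ^ (1 - σ) - ε ^ (-σ) * (1 - 2 ^ (1 - p)))) * ENNReal.ofReal k' := by
        rw [ENNReal.ofReal_coe_nnreal]
    _ = ENNReal.ofReal ((2 * (2 - ε ^ (1 - σ) - ε ^ (-σ) * (1 - 2 ^ (1 - p)))) * k') := by
        rw [ENNReal.ofReal_mul' hk0]
    _ ≤ ENNReal.ofReal g := ENNReal.ofReal_le_ofReal this
    _ = _ := ENNReal.ofReal_coe_nnreal

lemma hr_G {N : ℕ} (u : EuclideanSpace ℝ (Fin N) → ℝ) (hu : ContDiff ℝ (⊤ : ℕ∞) u)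
    (z : EuclideanSpace ℝ (Fin N)) :
    ∫⁻ x, ENNReal.ofReal |u (x + z) - u x| ≤ ∫⁻ x, ENNReal.ofReal |fderiv ℝ u x z| := by
  have hu1 : ContDiff ℝ 1 u := hu.of_le (by exact_mod_cast le_top)
  have hfc : Continuous (fderiv ℝ u) := hu1.continuous_fderiv (by norm_num)
  have hd : Differentiable ℝ u := hu1.differentiable (by norm_num)
  have hpt : ∀ x, ENNReal.ofReal |u (x + z) - u x| ≤
      ∫⁻ τ in Ioc (0 : ℝ) 1, ENNReal.ofReal |fderiv ℝ u (x + τ • z) z| := by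
    intro x
    have hder : ∀ τ : ℝ, HasDerivAt (fun τ : ℝ => u (x + τ • z)) (fderiv ℝ u (x + τ • z) z) τ := by
      intro τ
      have h1 : HasDerivAt (fun τ : ℝ => x + τ • z) z τ := by
        simpa using ((hasDerivAt_id τ).smul_const z).const_add x
      exact (hd (x + τ • z)).hasFDerivAt.comp_hasDerivAt τ h1
    have hftc := intervalIntegral.integral_eq_sub_of_hasDerivAt (a := 0) (b := 1)
      (fun τ _ => hder τ) (Continuous.intervalIntegrable (by fun_prop) _ _)
    simp only [one_smul, zero_smul, add_zero] at hftc
    rw [← hftc, intervalIntegral.integral_of_le zero_le_one]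
    have := enorm_integral_le_lintegral_enorm (μ := volume.restrict (Ioc (0:ℝ) 1))
      (fun τ : ℝ => fderiv ℝ u (x + τ • z) z)
    simpa only [Real.enorm_eq_ofReal_abs] using this
  calc _ ≤ ∫⁻ x, ∫⁻ τ in Ioc (0 : ℝ) 1, ENNReal.ofReal |fderiv ℝ u (x + τ • z) z| := lintegral_mono hpt
    _ = ∫⁻ τ in Ioc (0 : ℝ) 1, ∫⁻ x, ENNReal.ofReal |fderiv ℝ u (x + τ • z) z| := by
      apply lintegral_lintegral_swap
      apply Measurable.aemeasurable
      exact ENNReal.measurable_ofReal.comp (Continuous.measurable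
        (f := fun q : EuclideanSpace ℝ (Fin N) × ℝ => |fderiv ℝ u (q.1 + q.2 • z) z|) (by fun_prop))
    _ = ∫⁻ τ in Ioc (0 : ℝ) 1, ∫⁻ x, ENNReal.ofReal |fderiv ℝ u x z| := by
      congr 1; ext τ
      exact lintegral_add_right_eq_self (fun x => ENNReal.ofReal |fderiv ℝ u x z|) (τ • z)
    _ = _ := by simp

lemma hr_E (N : ℕ) (hN : 0 < N) (s p : ℝ) (hp : 1 ≤ p) (hσ1 : s * p < 1)
    (u : EuclideanSpace ℝ (Fin N) → ℝ) (hu : ContDiff ℝ (⊤ : ℕ∞) u)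
    (h0 : ∀ x, 0 ≤ u x) (h1 : ∀ x, u x ≤ 1) (E : Set (EuclideanSpace ℝ (Fin N)))
    (hE : ∀ x, x ∉ E → u x = 0) (hEm : MeasurableSet E) :
    gagliardo N s p univ u ≤
      ENNReal.ofReal (2 / (1 - s * p)) * hrK N hN (s * p) * (∫⁻ x, ENNReal.ofReal ‖fderiv ℝ u x‖)
      + 2 * volume E * ∫⁻ z in {z : EuclideanSpace ℝ (Fin N) | 1 ≤ ‖z‖}, hrKer N (s * p) z := by
  have hu1 : ContDiff ℝ 1 u := hu.of_le (by exact_mod_cast le_top)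
  have hfc : Continuous (fderiv ℝ u) := hu1.continuous_fderiv (by norm_num)
  have huc : Continuous u := hu.continuous
  set σ := s * p
  have hkm := hrKer_meas N σ
  have hum : Measurable u := huc.measurable
  have e1 : gagliardo N s p univ u ≤ ∫⁻ z, hrKer N σ z * ∫⁻ x, ENNReal.ofReal |u (x + z) - u x| := by
    rw [hr_gag]
    calc _ ≤ ∫⁻ x, ∫⁻ y, ENNReal.ofReal |u x - u y| * hrKer N σ (x - y) := by
          gcongr with x y
          have ha : |u x - u y| ≤ 1 := by
            rw [abs_le]; constructor <;> linarith [h0 x, h0 y, h1 x, h1 y]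
          calc |u x - u y| ^ p ≤ |u x - u y| ^ (1 : ℝ) :=
                Real.rpow_le_rpow_of_exponent_ge_of_imp (abs_nonneg _) ha hp (by intro _ h; linarith)
            _ = _ := Real.rpow_one _
      _ = ∫⁻ x, ∫⁻ z, ENNReal.ofReal |u (x + z) - u x| * hrKer N σ z := by
          congr 1; ext x
          rw [← lintegral_add_left_eq_self _ x]
          congr 1; ext z
          rw [abs_sub_comm]
          congr 1
          rw [← hrKer_neg]; congr 1; abel
      _ = ∫⁻ z, ∫⁻ x, ENNReal.ofReal |u (x + z) - u x| * hrKer N σ z := by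
          apply lintegral_lintegral_swap
          apply Measurable.aemeasurable
          unfold Function.uncurry
          fun_prop
      _ = _ := by
          congr 1; ext z
          rw [lintegral_mul_const _ (by fun_prop), mul_comm]
  refine e1.trans ?_
  rw [← lintegral_add_compl _ (measurableSet_ball (x := (0 : EuclideanSpace ℝ (Fin N))) (ε := 1))]
  have hset : (ball (0 : EuclideanSpace ℝ (Fin N)) 1)ᶜ = {z | 1 ≤ ‖z‖} := by
    ext z; simp
  gcongr ?_ + ?_
  · calc _ ≤ ∫⁻ z in ball (0 : EuclideanSpace ℝ (Fin N)) 1, ∫⁻ x, ENNReal.ofReal |fderiv ℝ u x z| * hrKer N σ z := by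
          apply lintegral_mono
          intro z
          dsimp only
          rw [lintegral_mul_const _ (by fun_prop), mul_comm]
          gcongr ?_ * _
          exact hr_G u hu z
      _ = ∫⁻ x, ∫⁻ z in ball (0 : EuclideanSpace ℝ (Fin N)) 1, ENNReal.ofReal |fderiv ℝ u x z| * hrKer N σ z := by
          apply lintegral_lintegral_swap
          apply Measurable.aemeasurable
          exact (ENNReal.measurable_ofReal.comp (Continuous.measurable
            (f := fun q : EuclideanSpace ℝ (Fin N) × EuclideanSpace ℝ (Fin N) => |fderiv ℝ u q.2 q.1|)
            (by fun_prop))).mul (hkm.comp measurable_fst)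
      _ ≤ ∫⁻ x, ENNReal.ofReal ‖fderiv ℝ u x‖ * (ENNReal.ofReal (2 / (1 - σ)) * hrK N hN σ) :=
          lintegral_mono (fun x => hrKappa N hN σ hσ1 _)
      _ = _ := by
          rw [lintegral_mul_const _ (by fun_prop), mul_comm]
  · rw [hset, ← lintegral_const_mul _ hkm]
    apply lintegral_mono
    intro z
    dsimp only
    rw [mul_comm]
    gcongr
    have hI : ∫⁻ x, ENNReal.ofReal (u x) ≤ volume E := by
      calc _ ≤ ∫⁻ x, E.indicator (fun _ => (1 : ℝ≥0∞)) x := by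
            apply lintegral_mono
            intro x
            by_cases hx : x ∈ E
            · simp [hx, h1]
            · simp [hE x hx]
        _ = _ := by rw [lintegral_indicator hEm]; simp
    calc _ ≤ ∫⁻ x, (ENNReal.ofReal (u (x + z)) + ENNReal.ofReal (u x)) := by
          apply lintegral_mono
          intro x
          dsimp only
          rw [← ENNReal.ofReal_add (h0 _) (h0 _)]
          apply ENNReal.ofReal_le_ofReal
          rw [abs_le]; constructor <;> linarith [h0 x, h0 (x + z)]
      _ = (∫⁻ x, ENNReal.ofReal (u x)) + ∫⁻ x, ENNReal.ofReal (u x) := by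
          rw [lintegral_add_left (by fun_prop), lintegral_add_right_eq_self (fun x => ENNReal.ofReal (u x))]
      _ ≤ _ := by rw [two_mul]; gcongr

lemma hr_S (N : ℕ) (s p : ℝ) (hp : 1 ≤ p) (U : Set (EuclideanSpace ℝ (Fin N))) (hU : IsOpen U)
    (hf : (frontier U).Nonempty) (u : EuclideanSpace ℝ (Fin N) → ℝ) (hu : ContDiff ℝ (⊤ : ℕ∞) u)
    (hcs : HasCompactSupport u) (hsup : tsupport u ⊆ U) (A : Set (EuclideanSpace ℝ (Fin N)))
    (hA : A ⊆ U) (hAm : MeasurableSet A) (hA1 : ∀ x ∈ A, u x = 1) :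
    hardyConst N s p U * (∫⁻ x in A, ENNReal.ofReal (infDist x (frontier U) ^ (-(s * p))))
      ≤ gagliardo N s p univ u := by
  set f : EuclideanSpace ℝ (Fin N) → ℝ := fun x => |u x| ^ p / infDist x (frontier U) ^ (s * p) with hfdef
  have hf0 : ∀ x, 0 ≤ f x := fun x => by
    have := infDist_nonneg (x := x) (s := frontier U)
    simp only [hfdef]; positivity
  have huc := hu.continuous
  have hcont : ContinuousOn f (tsupport u) := by
    apply ContinuousOn.div
    · apply Continuous.continuousOn
      exact huc.abs.rpow_const (fun x => Or.inr (by linarith))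
    · apply ContinuousOn.rpow_const (continuous_infDist_pt _).continuousOn
      intro x hx
      exact Or.inl (hr_infDist_pos hU (hsup hx) hf).ne'
    · intro x hx
      have := hr_infDist_pos hU (hsup hx) hf
      positivity
  have hint1 : IntegrableOn f (tsupport u) := hcont.integrableOn_compact hcs
  have hint : IntegrableOn f U := by
    apply hint1.of_forall_sdiff_eq_zero hU.measurableSet
    intro x hx
    have : u x = 0 := image_eq_zero_of_notMem_tsupport hx.2
    simp only [hfdef, this, abs_zero]
    rw [Real.zero_rpow (by linarith), zero_div]
  have hle : ∫⁻ x in A, ENNReal.ofReal (infDist x (frontier U) ^ (-(s * p))) ≤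
      ENNReal.ofReal (∫ x in U, f x) := by
    rw [ofReal_integral_eq_lintegral_ofReal hint (Eventually.of_forall hf0)]
    refine le_trans ?_ (lintegral_mono_set hA)
    apply setLIntegral_mono' hAm
    intro x hx
    simp only [hfdef, hA1 x hx, abs_one, Real.one_rpow]
    rw [Real.rpow_neg infDist_nonneg, one_div]
  set w := ∫ x in U, f x with hw
  refine le_trans (mul_le_mul_right hle _) ?_
  rcases (integral_nonneg hf0 : 0 ≤ w).eq_or_lt with hw0 | hw0
  · have hw1 : w = 0 := hw0.symm
    rw [hw1]; simp
  have hw0 : 0 < w := hw0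
  set c : ℝ := w ^ (-(1 / p)) with hc
  have hc0 : 0 < c := by positivity
  have hcp : c ^ p = w⁻¹ := by
    rw [hc, ← Real.rpow_mul hw0.le]
    have : -(1 / p) * p = -1 := by field_simp
    rw [this, Real.rpow_neg_one]
  have hmem : hardyConst N s p U ≤ gagliardo N s p univ (fun x => c * u x) := by
    apply sInf_le
    refine ⟨fun x => c * u x, contDiff_const.mul hu, hcs.mul_left, ?_, ?_, rfl⟩
    · exact (closure_mono (Function.support_mul_subset_right _ _)).trans hsup
    · have : ∀ x, |c * u x| ^ p / infDist x (frontier U) ^ (s * p) = w⁻¹ * f x := by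
        intro x
        rw [abs_mul, Real.mul_rpow (abs_nonneg _) (abs_nonneg _), abs_of_pos hc0, hcp, mul_div_assoc]
      simp_rw [this]
      rw [integral_const_mul, inv_mul_cancel₀ hw0.ne']
  have hscale : gagliardo N s p univ (fun x => c * u x) = ENNReal.ofReal w⁻¹ * gagliardo N s p univ u := by
    have hkm := hrKer_meas N (s * p)
    have hum := huc.measurable
    rw [hr_gag, hr_gag]
    have : ∀ x y, ENNReal.ofReal (|c * u x - c * u y| ^ p) * hrKer N (s * p) (x - y)
        = ENNReal.ofReal w⁻¹ * (ENNReal.ofReal (|u x - u y| ^ p) * hrKer N (s * p) (x - y)) := by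
      intro x y
      rw [← mul_sub, abs_mul, Real.mul_rpow (abs_nonneg _) (abs_nonneg _), abs_of_pos hc0, hcp,
        ENNReal.ofReal_mul (by positivity), mul_assoc]
    simp_rw [this]
    rw [← lintegral_const_mul' _ _ ENNReal.ofReal_ne_top]
    congr 1; ext x
    rw [lintegral_const_mul' _ _ ENNReal.ofReal_ne_top]
  rw [hscale] at hmem
  calc _ ≤ ENNReal.ofReal w⁻¹ * gagliardo N s p univ u * ENNReal.ofReal w := by gcongr
    _ = (ENNReal.ofReal w⁻¹ * ENNReal.ofReal w) * gagliardo N s p univ u := by ring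
    _ = _ := by
      rw [← ENNReal.ofReal_mul (by positivity), inv_mul_cancel₀ hw0.ne', ENNReal.ofReal_one, one_mul]

lemma hr_moll {N : ℕ} (v : EuclideanSpace ℝ (Fin N) → ℝ) (K : ℝ≥0) (hv : LipschitzWith K v)
    (h0 : ∀ x, 0 ≤ v x) (h1 : ∀ x, v x ≤ 1) (r : ℝ) (hr : 0 < r) :
    ∃ u : EuclideanSpace ℝ (Fin N) → ℝ, ContDiff ℝ (⊤ : ℕ∞) u ∧ LipschitzWith K u ∧
      (∀ x, 0 ≤ u x) ∧ (∀ x, u x ≤ 1) ∧ ∀ x, (∀ y ∈ ball x r, v y = v x) → u x = v x := by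
  let φ : ContDiffBump (0 : EuclideanSpace ℝ (Fin N)) := ⟨r / 2, r, by linarith, by linarith⟩
  set g := φ.normed volume with hg
  have hgc : Continuous g := φ.continuous_normed
  have hgs : HasCompactSupport g := φ.hasCompactSupport_normed
  have hg0 : ∀ x, 0 ≤ g x := φ.nonneg_normed
  have hg1 : ∫ x, g x = 1 := φ.integral_normed
  have hgi : Integrable g := hgc.integrable_of_hasCompactSupport hgs
  have hvc : Continuous v := hv.continuous
  have hint : ∀ x, Integrable (fun t => g t * v (x - t)) := fun x =>
    (Continuous.integrable_of_hasCompactSupport (by fun_prop) hgs.mul_right)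
  refine ⟨fun x => ∫ t, g t * v (x - t), ?_, ?_, ?_, ?_, ?_⟩
  · exact hgs.contDiff_convolution_left (ContinuousLinearMap.lsmul ℝ ℝ) φ.contDiff_normed
      (hvc.locallyIntegrable (μ := volume))
  · apply LipschitzWith.of_dist_le_mul
    intro x y
    rw [dist_eq_norm, ← integral_sub (hint x) (hint y)]
    calc _ ≤ ∫ t, g t * (K * dist x y) := by
          apply norm_integral_le_of_norm_le (hgi.mul_const _)
          refine Eventually.of_forall fun t => ?_
          rw [← mul_sub, norm_mul, Real.norm_of_nonneg (hg0 t)]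
          apply mul_le_mul_of_nonneg_left _ (hg0 t)
          have := hv.dist_le_mul (x - t) (y - t)
          rwa [dist_sub_right, dist_eq_norm] at this
      _ = _ := by rw [integral_mul_const, hg1, one_mul]
  · intro x
    exact integral_nonneg fun t => mul_nonneg (hg0 _) (h0 _)
  · intro x
    calc _ ≤ ∫ t, g t := integral_mono (hint x) hgi fun t => mul_le_of_le_one_right (hg0 _) (h1 _)
      _ = 1 := hg1
  · intro x hx
    exact φ.normed_convolution_eq_right (μ := volume) hx

lemma hr_T {N : ℕ} (E : Set (EuclideanSpace ℝ (Fin N))) (hE : IsOpen E) (hb : Bornology.IsBounded E)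
    (t l : ℝ) (ht : 0 < t) (hl : 1 < l) :
    ∃ u : EuclideanSpace ℝ (Fin N) → ℝ, ContDiff ℝ (⊤ : ℕ∞) u ∧ HasCompactSupport u ∧ tsupport u ⊆ E ∧
      (∀ x, 0 ≤ u x) ∧ (∀ x, u x ≤ 1) ∧ (∀ x, t ≤ infDist x Eᶜ → u x = 1) ∧
      ∫⁻ x, ENNReal.ofReal ‖fderiv ℝ u x‖ ≤
        ENNReal.ofReal (l / t) * volume {x | x ∈ E ∧ infDist x Eᶜ < t} := by
  set ρ : EuclideanSpace ℝ (Fin N) → ℝ := fun x => infDist x Eᶜ with hρ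
  obtain ⟨ε, hε, hε2⟩ : ∃ ε : ℝ, 0 < ε ∧ (1 - 2 * ε) = 1 / l := by
    refine ⟨(1 - 1 / l) / 2, ?_, by ring⟩
    have : 1 / l < 1 := by rw [div_lt_one (by linarith)]; exact hl
    linarith
  have hl0 : 0 < l := by linarith
  have hε3 : 0 < 1 - 2 * ε := by rw [hε2]; positivity
  have hρl : LipschitzWith 1 ρ := lipschitz_infDist_pt _
  have hρc : Continuous ρ := hρl.continuous
  set v : EuclideanSpace ℝ (Fin N) → ℝ := fun x => max 0 (min 1 ((ρ x - ε * t) * (l / t))) with hvdef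
  have hlt : 0 ≤ l / t := by positivity
  have hv : LipschitzWith (Real.toNNReal (l / t)) v := by
    apply LipschitzWith.of_dist_le_mul
    intro x y
    have hd := hρl.dist_le_mul x y
    rw [Real.dist_eq] at hd ⊢
    simp only [NNReal.coe_one, one_mul] at hd
    rw [Real.coe_toNNReal _ hlt]
    calc |v x - v y| ≤ |(ρ x - ε * t) * (l / t) - (ρ y - ε * t) * (l / t)| := by
          simp only [hvdef]
          refine (abs_max_sub_max_le_max _ _ _ _).trans ?_
          simp only [sub_self, abs_zero]
          refine max_le (abs_nonneg _) ?_
          refine (abs_min_sub_min_le_max _ _ _ _).trans ?_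
          simp
      _ = l / t * |ρ x - ρ y| := by
          rw [← sub_mul, abs_mul, abs_of_nonneg hlt]; ring_nf
      _ ≤ _ := by gcongr
  have h0 : ∀ x, 0 ≤ v x := fun x => le_max_left _ _
  have h1 : ∀ x, v x ≤ 1 := fun x => max_le zero_le_one (min_le_left _ _)
  have hv0 : ∀ x, ρ x ≤ ε * t → v x = 0 := by
    intro x hx
    apply max_eq_left
    refine (min_le_right _ _).trans ?_
    exact mul_nonpos_of_nonpos_of_nonneg (by linarith) hlt
  have hv1 : ∀ x, (1 - ε) * t ≤ ρ x → v x = 1 := by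
    intro x hx
    have : 1 ≤ (ρ x - ε * t) * (l / t) := by
      calc 1 = ((1 - 2 * ε) * t) * (l / t) := by rw [hε2]; field_simp
        _ ≤ _ := by gcongr; linarith
    simp only [hvdef, min_eq_left this]
    norm_num
  obtain ⟨u, hus, hul, hu0, hu1, huv⟩ := hr_moll v _ hv h0 h1 (ε * t / 2) (by positivity)
  have hball : ∀ x y, y ∈ ball x (ε * t / 2) → |ρ y - ρ x| < ε * t / 2 := by
    intro x y hy
    have := hρl.dist_le_mul y x
    rw [Real.dist_eq] at this
    simp only [NNReal.coe_one, one_mul] at this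
    exact this.trans_lt hy
  have hu1' : ∀ x, (1 - ε / 2) * t ≤ ρ x → u x = 1 := by
    intro x hx
    have hx1 : v x = 1 := hv1 x (by nlinarith)
    rw [huv x, hx1]
    intro y hy
    have := abs_lt.1 (hball x y hy)
    rw [hx1, hv1 y (by nlinarith)]
  have hu0' : ∀ x, ρ x ≤ ε * t / 2 → u x = 0 := by
    intro x hx
    have hx1 : v x = 0 := hv0 x (by nlinarith)
    rw [huv x, hx1]
    intro y hy
    have := abs_lt.1 (hball x y hy)
    rw [hx1, hv0 y (by nlinarith)]
  have hclosed : IsClosed {x | ε * t / 2 ≤ ρ x} := isClosed_le continuous_const hρc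
  have hsubE : {x | ε * t / 2 ≤ ρ x} ⊆ E := by
    intro x hx
    by_contra hxE
    have : ρ x = 0 := infDist_zero_of_mem hxE
    have h2 : ε * t / 2 ≤ ρ x := hx
    have : 0 < ε * t := by positivity
    linarith
  have htsup : tsupport u ⊆ {x | ε * t / 2 ≤ ρ x} := by
    apply closure_minimal _ hclosed
    intro x hx
    by_contra hx2
    exact hx (hu0' x (not_le.1 hx2).le)
  refine ⟨u, hus, ?_, htsup.trans hsubE, hu0, hu1, ?_, ?_⟩
  · exact (isCompact_of_isClosed_isBounded hclosed (hb.subset hsubE)).of_isClosed_subset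
      (isClosed_tsupport u) htsup
  · intro x hx
    exact hu1' x (by change t ≤ ρ x at hx; nlinarith)
  · have hms : MeasurableSet {x | x ∈ E ∧ ρ x < t} :=
      hE.measurableSet.inter (measurableSet_lt hρc.measurable measurable_const)
    rw [← setLIntegral_const, ← lintegral_indicator hms]
    apply lintegral_mono
    intro x
    by_cases hx : x ∈ {x | x ∈ E ∧ ρ x < t}
    · simp only [indicator_of_mem hx]
      apply ENNReal.ofReal_le_ofReal
      have := norm_fderiv_le_of_lipschitz ℝ hul (x₀ := x)
      rwa [Real.coe_toNNReal _ hlt] at this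
    · simp only [indicator_of_notMem hx, nonpos_iff_eq_zero, ENNReal.ofReal_eq_zero]
      have hz : fderiv ℝ u x = 0 := by
        by_cases hxE : x ∈ E
        · have hxt : t ≤ ρ x := by
            by_contra h; exact hx ⟨hxE, not_le.1 h⟩
          have : u =ᶠ[nhds x] fun _ => (1 : ℝ) := by
            have hop : IsOpen {y | (1 - ε / 2) * t < ρ y} := isOpen_lt continuous_const hρc
            filter_upwards [hop.mem_nhds (show (1 - ε / 2) * t < ρ x by nlinarith)] with y hy
            exact hu1' y (le_of_lt hy)
          rw [this.fderiv_eq]; simp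
        · have hx0 : ρ x = 0 := infDist_zero_of_mem hxE
          have : u =ᶠ[nhds x] fun _ => (0 : ℝ) := by
            have hop : IsOpen {y | ρ y < ε * t / 2} := isOpen_lt hρc continuous_const
            filter_upwards [hop.mem_nhds (show ρ x < ε * t / 2 by rw [hx0]; positivity)] with y hy
            exact hu0' y (le_of_lt hy)
          rw [this.fderiv_eq]; simp
      rw [hz]; simp

lemma hr_W {N : ℕ} (E : Set (EuclideanSpace ℝ (Fin N))) (hE : MeasurableSet E)
    (d : EuclideanSpace ℝ (Fin N) → ℝ) (hd : Continuous d) (hpos : ∀ x ∈ E, 0 < d x)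
    (M t0 σ : ℝ) (hM : 0 < M) (ht0 : 0 < t0) (hσ : 0 < σ) (hσ1 : σ < 1)
    (hV : ∀ t ∈ Ioc 0 t0, ENNReal.ofReal (M * t) ≤ volume {x | x ∈ E ∧ d x < t}) :
    ENNReal.ofReal (M * σ * (t0 ^ (1 - σ) / (1 - σ))) ≤ ∫⁻ x in E, ENNReal.ofReal (d x ^ (-σ)) := by
  have key : ∀ x ∈ E, ∫⁻ t in Ioc 0 t0, (if d x < t then ENNReal.ofReal (σ * t ^ (-σ - 1)) else 0)
      ≤ ENNReal.ofReal (d x ^ (-σ)) := by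
    intro x hx
    have hx0 := hpos x hx
    calc _ ≤ ∫⁻ t in Ioi (d x), ENNReal.ofReal (σ * t ^ (-σ - 1)) := by
          rw [← lintegral_indicator measurableSet_Ioc, ← lintegral_indicator measurableSet_Ioi]
          apply lintegral_mono
          intro t
          by_cases h1 : t ∈ Ioc 0 t0
          · by_cases h2 : d x < t
            · simp [indicator, h1, h2]
            · simp [indicator, h2]
          · simp [indicator_of_notMem h1]
      _ = ENNReal.ofReal (∫ t in Ioi (d x), σ * t ^ (-σ - 1)) := by
          rw [ofReal_integral_eq_lintegral_ofReal]
          · exact (integrableOn_Ioi_rpow_of_lt (by linarith) hx0).const_mul σ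
          · refine (ae_restrict_iff' measurableSet_Ioi).2 (Eventually.of_forall fun t ht => ?_)
            have : 0 < t := hx0.trans ht
            simp only [Pi.zero_apply]; positivity
      _ = _ := by
          rw [integral_const_mul, integral_Ioi_rpow_of_lt (by linarith) hx0]
          congr 1
          have : -σ - 1 + 1 = -σ := by ring
          rw [this]; field_simp
  calc ENNReal.ofReal (M * σ * (t0 ^ (1 - σ) / (1 - σ)))
      = ENNReal.ofReal (M * σ) * ∫⁻ t in Ioc 0 t0, ENNReal.ofReal (t ^ (-σ)) := by
        rw [hr_tau σ hσ1 t0 ht0, ENNReal.ofReal_mul (by positivity)]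
    _ = ∫⁻ t in Ioc 0 t0, ENNReal.ofReal (M * σ) * ENNReal.ofReal (t ^ (-σ)) := by
        rw [lintegral_const_mul' _ _ ENNReal.ofReal_ne_top]
    _ ≤ ∫⁻ t in Ioc 0 t0, ∫⁻ x in E, (if d x < t then ENNReal.ofReal (σ * t ^ (-σ - 1)) else 0) := by
        apply setLIntegral_mono' measurableSet_Ioc
        intro t ht
        have ht' : 0 < t := ht.1
        have hms : MeasurableSet {x | d x < t} := measurableSet_lt hd.measurable measurable_const
        have : ∫⁻ x in E, (if d x < t then ENNReal.ofReal (σ * t ^ (-σ - 1)) else 0)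
            = ENNReal.ofReal (σ * t ^ (-σ - 1)) * volume {x | x ∈ E ∧ d x < t} := by
          have e : (fun x => if d x < t then ENNReal.ofReal (σ * t ^ (-σ - 1)) else 0)
             = indicator {x | d x < t} (fun _ => ENNReal.ofReal (σ * t ^ (-σ - 1))) := by
            ext x; simp [indicator]
          rw [e, lintegral_indicator hms, setLIntegral_const, Measure.restrict_apply hms]
          congr 2
          ext x; simp [and_comm]
        rw [this]
        refine le_trans ?_ (mul_le_mul_right (hV t ht) _)
        rw [← ENNReal.ofReal_mul (by positivity), ← ENNReal.ofReal_mul (by positivity)]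
        apply ENNReal.ofReal_le_ofReal
        have : t ^ (-σ) = t ^ (-σ - 1) * t := by
          nth_rewrite 3 [← Real.rpow_one t]
          rw [← Real.rpow_add ht']; ring_nf
        rw [this]; apply le_of_eq; ring
    _ = ∫⁻ x in E, ∫⁻ t in Ioc 0 t0, (if d x < t then ENNReal.ofReal (σ * t ^ (-σ - 1)) else 0) := by
        apply lintegral_lintegral_swap
        apply Measurable.aemeasurable
        apply Measurable.ite
        · exact measurableSet_lt (hd.measurable.comp measurable_snd) measurable_fst
        · fun_prop
        · fun_prop
    _ ≤ _ := setLIntegral_mono' hE key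

lemma hr_b1 (N : ℕ) (hN : 0 < N) (U : Set (EuclideanSpace ℝ (Fin N))) (hU : IsOpen U)
    (hf : (frontier U).Nonempty) (E : Set (EuclideanSpace ℝ (Fin N))) (hE : IsOpen E)
    (hb : Bornology.IsBounded E) (hEU : E ⊆ U) (M : ℝ) (hM : 0 < M)
    (hfr : ∃ᶠ t in nhdsWithin (0 : ℝ) (Ioi 0), volume {x | x ∈ E ∧ infDist x Eᶜ < t} ≤ ENNReal.ofReal (M * t))
    (l : ℝ) (hl : 1 < l) (s p : ℝ) (hp : 1 ≤ p) (hσ1 : s * p < 1) :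
    hardyConst N s p U * (∫⁻ x in E, ENNReal.ofReal (infDist x (frontier U) ^ (-(s * p)))) ≤
      ENNReal.ofReal (2 / (1 - s * p)) * hrK N hN (s * p) * ENNReal.ofReal (l * M)
      + 2 * volume E * ∫⁻ z in {z : EuclideanSpace ℝ (Fin N) | 1 ≤ ‖z‖}, hrKer N (s * p) z := by
  have hEne : Eᶜ.Nonempty := by
    obtain ⟨x, hx⟩ := hf
    refine ⟨x, fun h => ?_⟩
    have := hU.frontier_eq ▸ hx
    exact this.2 (hEU h)
  have hρc : Continuous (fun x : EuclideanSpace ℝ (Fin N) => infDist x Eᶜ) := continuous_infDist_pt _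
  set A : ℕ → Set (EuclideanSpace ℝ (Fin N)) := fun n => {x | x ∈ E ∧ 1 / ((n : ℝ) + 1) ≤ infDist x Eᶜ} with hA
  have hAm : ∀ n, MeasurableSet (A n) := fun n =>
    hE.measurableSet.inter (measurableSet_le measurable_const hρc.measurable)
  have hAmono : Monotone A := by
    intro m n hmn x hx
    refine ⟨hx.1, le_trans ?_ hx.2⟩
    have : (m : ℝ) ≤ n := by exact_mod_cast hmn
    gcongr
  have hAE : (⋃ n, A n) = E := by
    ext x
    simp only [mem_iUnion]
    constructor
    · rintro ⟨n, hx⟩; exact hx.1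
    · intro hx
      have h0 : 0 < infDist x Eᶜ :=
        (hE.isClosed_compl.notMem_iff_infDist_pos hEne).1 (by simpa using hx)
      obtain ⟨n, hn⟩ := exists_nat_one_div_lt h0
      exact ⟨n, hx, hn.le⟩
  rw [← hAE, setLIntegral_iUnion_of_directed _ (directed_of_isDirected_le hAmono), ENNReal.mul_iSup, hAE]
  apply iSup_le
  intro n
  have hev : ∀ᶠ t in nhdsWithin (0 : ℝ) (Ioi 0), 0 < t ∧ t < 1 / ((n : ℝ) + 1) := by
    have : Ioo (0 : ℝ) (1 / ((n : ℝ) + 1)) ∈ nhdsWithin (0 : ℝ) (Ioi 0) :=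
      Ioo_mem_nhdsGT (by positivity)
    exact this
  obtain ⟨t, htV, ht0, htn⟩ := (hfr.and_eventually hev).exists
  obtain ⟨u, hus, hucs, hut, hu0, hu1, hue, huI⟩ := hr_T E hE hb t l ht0 hl
  refine (hr_S N s p hp U hU hf u hus hucs (hut.trans hEU) (A n) (fun x hx => hEU hx.1) (hAm n)
    (fun x hx => hue x (htn.le.trans hx.2))).trans ?_
  refine (hr_E N hN s p hp hσ1 u hus hu0 hu1 E ?_ hE.measurableSet).trans ?_
  · intro x hx
    exact image_eq_zero_of_notMem_tsupport (fun h => hx (hut h))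
  · gcongr
    refine huI.trans ((mul_le_mul_right htV _).trans ?_)
    rw [← ENNReal.ofReal_mul (by positivity)]
    apply ENNReal.ofReal_le_ofReal
    apply le_of_eq; field_simp

lemma hr_b (N : ℕ) (hN : 0 < N) (U : Set (EuclideanSpace ℝ (Fin N))) (hU : IsOpen U)
    (hf : (frontier U).Nonempty) (E : Set (EuclideanSpace ℝ (Fin N))) (hE : IsOpen E)
    (hb : Bornology.IsBounded E) (hEU : E ⊆ U) (M M' t0 : ℝ) (hM : 0 < M) (hM' : 0 < M') (ht0 : 0 < t0)
    (hfr : ∃ᶠ t in nhdsWithin (0 : ℝ) (Ioi 0), volume {x | x ∈ E ∧ infDist x Eᶜ < t} ≤ ENNReal.ofReal (M * t))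
    (hV : ∀ t ∈ Ioc 0 t0, ENNReal.ofReal (M' * t) ≤ volume {x | x ∈ E ∧ infDist x (frontier U) < t})
    (L : ℝ) (hL : 2 * M / M' < L) :
    ∃ σ0 < (1 : ℝ), ∀ s p : ℝ, 1 ≤ p → σ0 < s * p → s * p < 1 →
      hardyConst N s p U ≤ ENNReal.ofReal L * hrK N hN (s * p) := by
  obtain ⟨l, hl, hlL⟩ : ∃ l : ℝ, 1 < l ∧ 2 * (l * M) / M' < L := by
    have hc : ContinuousAt (fun l : ℝ => 2 * (l * M) / M') 1 := by fun_prop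
    have h2 : ∀ᶠ l in nhds (1 : ℝ), 2 * (l * M) / M' < L :=
      hc.eventually_lt_const (by simpa using hL)
    have h3 : ∀ᶠ l in nhdsWithin (1 : ℝ) (Ioi 1), 1 < l := eventually_mem_nhdsWithin
    exact (h3.and (h2.filter_mono nhdsWithin_le_nhds)).exists
  have hl0 : 0 < l := by linarith
  set C := ∫⁻ z in {z : EuclideanSpace ℝ (Fin N) | 1 ≤ ‖z‖}, hrKer N (1 / 2) z with hC
  have hCf : C < ∞ := hrC_fin N (1 / 2) (by norm_num)
  have hEv : volume E < ∞ := hb.measure_lt_top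
  have hk1 := hrK_pos N hN 1
  have hk1f := hrK_fin N hN 1 one_pos
  set Q : ℝ := (2 * volume E * C / hrK N hN 1).toReal with hQ
  have hQ0 : 0 ≤ Q := ENNReal.toReal_nonneg
  have hnum : 2 * volume E * C ≠ ∞ := by finiteness
  have hQe : 2 * volume E * C = ENNReal.ofReal Q * hrK N hN 1 := by
    rw [hQ, ENNReal.ofReal_toReal (ENNReal.div_ne_top hnum hk1.ne'),
      ENNReal.div_mul_cancel hk1.ne' hk1f.ne]
  have hlim : ∀ᶠ σ in nhds (1 : ℝ), (2 * (l * M) + Q * (1 - σ)) / (M' * σ * t0 ^ (1 - σ)) < L := by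
    have hc : ContinuousAt (fun σ : ℝ => (2 * (l * M) + Q * (1 - σ)) / (M' * σ * t0 ^ (1 - σ))) 1 := by
      apply ContinuousAt.div
      · fun_prop
      · apply ContinuousAt.mul (by fun_prop)
        exact ContinuousAt.rpow (by fun_prop) (by fun_prop) (Or.inl ht0.ne')
      · simp [hM'.ne']
    exact hc.eventually_lt_const (by simpa using hlL)
  obtain ⟨δ, hδ, hδ2⟩ := Metric.eventually_nhds_iff.1 hlim
  refine ⟨max (1 / 2) (1 - δ), max_lt (by norm_num) (by linarith), ?_⟩
  intro s p hp hσ hσ1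
  have h1 := hr_b1 N hN U hU hf E hE hb hEU M hM hfr l hl s p hp hσ1
  set σ := s * p with hσdef
  have hσh : 1 / 2 < σ := (le_max_left _ _).trans_lt hσ
  have hσd : 1 - δ < σ := (le_max_right _ _).trans_lt hσ
  have hσ0 : 0 < σ := by linarith
  have hW := hr_W E hE.measurableSet (fun x => infDist x (frontier U)) (continuous_infDist_pt _)
    (fun x hx => hr_infDist_pos hU (hEU hx) hf) M' t0 σ hM' ht0 hσ0 hσ1 hV
  have h2 := (mul_le_mul_right hW (hardyConst N s p U)).trans h1
  have hQk : 2 * volume E * ∫⁻ z in {z : EuclideanSpace ℝ (Fin N) | 1 ≤ ‖z‖}, hrKer N σ z ≤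
      ENNReal.ofReal Q * hrK N hN σ :=
    calc _ ≤ 2 * volume E * C := by gcongr; exact hrC_mono N (1 / 2) σ hσh.le
      _ = _ := hQe
      _ ≤ _ := by gcongr; exact hrK_anti N hN _ _ hσ1.le
  set D := M' * σ * (t0 ^ (1 - σ) / (1 - σ)) with hD
  have h1σ : 0 < 1 - σ := by linarith
  have hD0 : 0 < D := by positivity
  have h3 : hardyConst N s p U * ENNReal.ofReal D ≤
      ENNReal.ofReal (2 / (1 - σ) * (l * M) + Q) * hrK N hN σ := by
    refine h2.trans ((add_le_add_right hQk _).trans (le_of_eq ?_))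
    rw [ENNReal.ofReal_add (by positivity) hQ0,
      ENNReal.ofReal_mul (show (0 : ℝ) ≤ 2 / (1 - σ) by positivity)]
    ring
  have h4 : hardyConst N s p U ≤ ENNReal.ofReal (2 / (1 - σ) * (l * M) + Q) * hrK N hN σ / ENNReal.ofReal D := by
    rw [ENNReal.le_div_iff_mul_le (Or.inl (by simpa using hD0)) (Or.inl ENNReal.ofReal_ne_top)]
    exact h3
  refine h4.trans ?_
  rw [mul_comm, mul_div_assoc, ← ENNReal.ofReal_div_of_pos hD0, mul_comm]
  gcongr
  have h5 := hδ2 (y := σ) (by rw [Real.dist_eq, abs_lt]; constructor <;> linarith)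
  refine le_trans (le_of_eq ?_) h5.le
  rw [hD]
  field_simp

lemma hr_V_up (N : ℕ) (Ω : Set (EuclideanSpace ℝ (Fin N))) (hop : IsOpen Ω) (hconv : Convex ℝ Ω)
    (hbd : Bornology.IsBounded Ω) (hc : Ωᶜ.Nonempty) (x0 : EuclideanSpace ℝ (Fin N)) (r : ℝ) (hr : 0 < r)
    (hball : ball x0 r ⊆ Ω) (t : ℝ) (ht : 0 < t) (htr : t ≤ r) :
    volume {x | x ∈ Ω ∧ infDist x Ωᶜ < t} ≤ ENNReal.ofReal ((volume Ω).toReal * N / r * t) := by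
  set c := 1 - t / r with hcdef
  have h1c : 0 < 1 - c := by rw [hcdef]; simp; positivity
  have hc0 : 0 ≤ c := by
    have : t / r ≤ 1 := by rw [div_le_one hr]; exact htr
    linarith
  set A := AffineMap.homothety x0 c '' Ω with hA
  have hin : ∀ x ∈ A, ball x t ⊆ Ω := by
    rintro _ ⟨y, hy, rfl⟩ w hw
    set x := AffineMap.homothety x0 c y with hx
    have hxe : x = c • (y - x0) + x0 := by simp [hx, AffineMap.homothety_apply]
    have hz : x0 + (1 - c)⁻¹ • (w - x) ∈ Ω := by
      apply hball
      rw [mem_ball, dist_eq_norm, add_sub_cancel_left, norm_smul, Real.norm_of_nonneg (by positivity)]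
      rw [mem_ball, dist_eq_norm] at hw
      have e : 1 - c = t / r := by rw [hcdef]; ring
      calc _ < (1 - c)⁻¹ * t := by gcongr
        _ = r := by rw [e]; field_simp
    have := hconv hy hz hc0 h1c.le (by ring)
    convert this using 1
    rw [smul_add, smul_smul, mul_inv_cancel₀ h1c.ne', one_smul, hxe]
    module
  have hAΩ : A ⊆ Ω := fun x hx => hin x hx (mem_ball_self ht)
  have hsub : {x | x ∈ Ω ∧ infDist x Ωᶜ < t} ⊆ Ω \ A := by
    rintro x ⟨hx, hxt⟩
    refine ⟨hx, fun hxA => ?_⟩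
    obtain ⟨y, hy, hyt⟩ := (infDist_lt_iff hc).1 hxt
    exact hy (hin x hxA (by rwa [mem_ball, dist_comm]))
  have hvA : volume A = ENNReal.ofReal (c ^ N) * volume Ω := by
    rw [hA, Measure.addHaar_image_homothety]
    simp [abs_of_nonneg hc0]
  have hΩf : volume Ω ≠ ∞ := hbd.measure_lt_top.ne
  have hAf : volume A ≠ ∞ := measure_ne_top_of_subset hAΩ hΩf
  have hAm : NullMeasurableSet A volume := by
    rw [hA]
    have hcv : Convex ℝ (AffineMap.homothety x0 c '' Ω) := hconv.affine_image _
    exact hcv.nullMeasurableSet volume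
  calc _ ≤ volume (Ω \ A) := measure_mono hsub
    _ = volume Ω - volume A := measure_sdiff hAΩ hAm hAf
    _ = ENNReal.ofReal ((volume Ω).toReal - c ^ N * (volume Ω).toReal) := by
        rw [hvA, ENNReal.ofReal_sub _ (by positivity), ENNReal.ofReal_mul (by positivity),
          ENNReal.ofReal_toReal hΩf]
    _ ≤ _ := by
        apply ENNReal.ofReal_le_ofReal
        have hb := one_add_mul_le_pow (a := -(t / r)) (by rw [hcdef] at hc0; linarith) N
        have e : 1 + -(t / r) = c := by rw [hcdef]; ring
        rw [e] at hb
        have hv : 0 ≤ (volume Ω).toReal := ENNReal.toReal_nonneg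
        calc _ = (volume Ω).toReal * (1 - c ^ N) := by ring
          _ ≤ (volume Ω).toReal * (N * (t / r)) := by gcongr; linarith
          _ = _ := by ring

lemma hr_V_lo (N : ℕ) (hN : 0 < N) (Ω : Set (EuclideanSpace ℝ (Fin N)))
    (hbd : Bornology.IsBounded Ω) (x0 : EuclideanSpace ℝ (Fin N)) (R : ℝ) (hR : 0 < R)
    (hball : Ω ⊆ ball x0 R) (t : ℝ) (ht : 0 < t) (htr : t ≤ R) :
    ENNReal.ofReal ((volume Ω).toReal / (2 * R) * t) ≤ volume {x | x ∈ Ω ∧ infDist x Ωᶜ < t} := by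
  set b := 1 + t / R with hb
  have hb0 : 0 < b := by positivity
  set A := AffineMap.homothety x0 b⁻¹ '' Ω with hA
  have hsub : Ω ⊆ {x | x ∈ Ω ∧ infDist x Ωᶜ < t} ∪ A := by
    intro x hx
    by_cases hxt : infDist x Ωᶜ < t
    · exact Or.inl ⟨hx, hxt⟩
    right
    refine ⟨b • (x - x0) + x0, ?_, ?_⟩
    · by_contra hy
      apply hxt
      refine (infDist_le_dist_of_mem (s := Ωᶜ) hy).trans_lt ?_
      have e : x - (b • (x - x0) + x0) = (-(t / R)) • (x - x0) := by
        rw [hb]; module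
      rw [dist_eq_norm, e, norm_smul, norm_neg, Real.norm_of_nonneg (by positivity)]
      have h2 : ‖x - x0‖ < R := by
        rw [← dist_eq_norm]; exact hball hx
      calc _ < t / R * R := by gcongr
        _ = t := by field_simp
    · simp [AffineMap.homothety_apply, smul_smul, inv_mul_cancel₀ hb0.ne']
  have hvA : volume A = ENNReal.ofReal (b⁻¹ ^ N) * volume Ω := by
    rw [hA, Measure.addHaar_image_homothety]
    rw [finrank_euclideanSpace_fin, abs_of_nonneg (by positivity)]
  have hΩf : volume Ω ≠ ∞ := hbd.measure_lt_top.ne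
  have hv : 0 ≤ (volume Ω).toReal := ENNReal.toReal_nonneg
  have h1 : volume Ω ≤ volume {x | x ∈ Ω ∧ infDist x Ωᶜ < t} + volume A :=
    (measure_mono hsub).trans (measure_union_le _ _)
  calc _ ≤ ENNReal.ofReal ((volume Ω).toReal - b⁻¹ ^ N * (volume Ω).toReal) := by
        apply ENNReal.ofReal_le_ofReal
        have hb1 : b⁻¹ ≤ 1 := inv_le_one_of_one_le₀ (by rw [hb]; simp; positivity)
        have h2 : b⁻¹ ^ N ≤ b⁻¹ := pow_le_of_le_one (by positivity) hb1 hN.ne'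
        have h3 : t / (2 * R) ≤ 1 - b⁻¹ := by
          have e : 1 - b⁻¹ = t / (R + t) := by rw [hb]; field_simp; ring
          rw [e]; gcongr; linarith
        calc _ = (volume Ω).toReal * (t / (2 * R)) := by ring
          _ ≤ (volume Ω).toReal * (1 - b⁻¹ ^ N) := by gcongr; linarith
          _ = _ := by ring
    _ = volume Ω - volume A := by
        rw [hvA, ENNReal.ofReal_sub _ (by positivity), ENNReal.ofReal_mul (by positivity),
          ENNReal.ofReal_toReal hΩf]
    _ ≤ _ := tsub_le_iff_right.2 h1

lemma hr_omega (N : ℕ) (hN : 0 < N) (Ω : Set (EuclideanSpace ℝ (Fin N))) (hne : Ω.Nonempty)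
    (hop : IsOpen Ω) (hconv : Convex ℝ Ω) (hbd : Bornology.IsBounded Ω)
    (hf : (frontier Ω).Nonempty) (hc : Ωᶜ.Nonempty) (L : ℝ) (hL : 2 < L) :
    ∃ σ0 < (1 : ℝ), ∀ s p : ℝ, 1 ≤ p → σ0 < s * p → s * p < 1 →
      hardyConst N s p Ω ≤ ENNReal.ofReal L * hrK N hN (s * p) := by
  obtain ⟨x0, hx0⟩ := hne
  obtain ⟨r, hr, hrb⟩ := Metric.isOpen_iff.1 hop x0 hx0
  obtain ⟨R, hR, hRb⟩ := hbd.subset_ball_lt 0 x0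
  have hΩf : volume Ω ≠ ∞ := hbd.measure_lt_top.ne
  have hΩp : 0 < (volume Ω).toReal := ENNReal.toReal_pos (hop.measure_pos _ ⟨x0, hx0⟩).ne' hΩf
  set V : ℝ → ℝ≥0∞ := fun t => volume {x | x ∈ Ω ∧ infDist x Ωᶜ < t} with hV
  set F := nhdsWithin (0 : ℝ) (Ioi 0) with hF
  set M0 := liminf (fun t => V t / ENNReal.ofReal t) F with hM0
  have hup : M0 ≤ ENNReal.ofReal ((volume Ω).toReal * N / r) := by
    apply liminf_le_of_frequently_le'
    apply Eventually.frequently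
    filter_upwards [Ioc_mem_nhdsGT hr] with t ht
    rw [ENNReal.div_le_iff (by simpa using ht.1) ENNReal.ofReal_ne_top,
      ← ENNReal.ofReal_mul (by positivity)]
    exact hr_V_up N Ω hop hconv hbd hc x0 r hr hrb t ht.1 ht.2
  have hlo : ENNReal.ofReal ((volume Ω).toReal / (2 * R)) ≤ M0 := by
    apply le_liminf_of_le
    · isBoundedDefault
    filter_upwards [Ioc_mem_nhdsGT hR] with t ht
    rw [ENNReal.le_div_iff_mul_le (Or.inl (by simpa using ht.1)) (Or.inl ENNReal.ofReal_ne_top),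
      ← ENNReal.ofReal_mul (by positivity)]
    exact hr_V_lo N hN Ω hbd x0 R hR hRb t ht.1 ht.2
  have hM0f : M0 ≠ ∞ := (hup.trans_lt ENNReal.ofReal_lt_top).ne
  have hM0p : 0 < M0 := lt_of_lt_of_le (by simp; positivity) hlo
  set m := M0.toReal with hm
  have hmp : 0 < m := ENNReal.toReal_pos hM0p.ne' hM0f
  have hmM : ENNReal.ofReal m = M0 := ENNReal.ofReal_toReal hM0f
  obtain ⟨a, ha1, haL⟩ : ∃ a : ℝ, 1 < a ∧ 2 * a ^ 2 < L := by
    have hca : ContinuousAt (fun a : ℝ => 2 * a ^ 2) 1 := by fun_prop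
    have h2 : ∀ᶠ a in nhds (1 : ℝ), 2 * a ^ 2 < L :=
      hca.eventually_lt_const (by simpa using hL)
    have h3 : ∀ᶠ a in nhdsWithin (1 : ℝ) (Ioi 1), 1 < a := eventually_mem_nhdsWithin
    exact (h3.and (h2.filter_mono nhdsWithin_le_nhds)).exists
  have ha0 : 0 < a := by linarith
  have hfreq : ∃ᶠ t in F, V t / ENNReal.ofReal t < ENNReal.ofReal (m * a) := by
    apply frequently_lt_of_liminf_lt
    · isBoundedDefault
    · rw [← hM0, ← hmM]
      exact (ENNReal.ofReal_lt_ofReal_iff (by positivity)).2 (by nlinarith)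
  have hev : ∀ᶠ t in F, ENNReal.ofReal (m / a) < V t / ENNReal.ofReal t := by
    apply eventually_lt_of_lt_liminf
    · rw [← hM0, ← hmM]
      exact (ENNReal.ofReal_lt_ofReal_iff (by positivity)).2 (div_lt_self hmp ha1)
    · isBoundedDefault
  have hpos : ∀ᶠ t in F, 0 < t := eventually_mem_nhdsWithin
  obtain ⟨t0, ht0, ht0V⟩ := mem_nhdsGT_iff_exists_Ioc_subset.1 hev
  refine hr_b N hN Ω hop hf Ω hop hbd subset_rfl (m * a) (m / a) t0 (by positivity) (by positivity) ht0
    ?_ ?_ L ?_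
  · refine (hfreq.and_eventually hpos).mono ?_
    rintro t ⟨h, ht⟩
    rw [ENNReal.ofReal_mul (by positivity)]
    rw [ENNReal.div_lt_iff (Or.inl (by simpa using ht)) (Or.inl ENNReal.ofReal_ne_top)] at h
    exact h.le
  · intro t ht
    have h : ENNReal.ofReal (m / a) < V t / ENNReal.ofReal t := ht0V ht
    rw [ENNReal.ofReal_mul (by positivity)]
    have h2 := ENNReal.mul_le_of_le_div h.le
    refine h2.trans (le_of_eq ?_)
    simp only [hV]
    congr 1
    ext x
    simp only [mem_ofPred_eq]
    refine and_congr_right fun hx => ?_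
    rw [hr_infDist hop hx hf]
  · refine lt_of_le_of_lt (le_of_eq ?_) haL
    field_simp

lemma hr_box_vol {N : ℕ} (a b : Fin N → ℝ) :
    volume {x : EuclideanSpace ℝ (Fin N) | ∀ i, x i ∈ Ioo (a i) (b i)} =
      ∏ i, ENNReal.ofReal (b i - a i) := by
  rw [← Real.volume_pi_Ioo, ← (PiLp.volume_preserving_ofLp (Fin N)).measure_preimage
    (MeasurableSet.univ_pi fun i => measurableSet_Ioo).nullMeasurableSet]
  congr 1
  ext x; simp [Set.mem_pi]

lemma hr_box_prod {R : Type*} [CommMonoid R] {N : ℕ} (hN : 0 < N) (A B : R) :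
    ∏ i : Fin N, (if i = ⟨0, hN⟩ then A else B) = A * B ^ (N - 1) := by
  rw [← Finset.mul_prod_erase Finset.univ _ (Finset.mem_univ (⟨0, hN⟩ : Fin N))]
  rw [Finset.prod_congr rfl (g := fun _ => B) (by
    intro i hi; rw [if_neg (Finset.ne_of_mem_erase hi)])]
  simp

lemma hr_half (N : ℕ) (hN : 0 < N) (L : ℝ) (hL : 4 < L) :
    ∃ σ0 < (1 : ℝ), ∀ s p : ℝ, 1 ≤ p → σ0 < s * p → s * p < 1 →
      hardyConst N s p (halfSpace N hN) ≤ ENNReal.ofReal L * hrK N hN (s * p) := by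
  set n : ℕ := N - 1 with hn
  set δ : ℝ := (L - 4) / (4 * (n + 1)) with hδ
  have hδ0 : 0 < δ := by
    have : 0 < L - 4 := by linarith
    positivity
  set c : Fin N → ℝ := fun i => if i = ⟨0, hN⟩ then δ else 1 with hc
  set E : Set (EuclideanSpace ℝ (Fin N)) := {x | ∀ i, x i ∈ Ioo 0 (c i)} with hE
  have hEpre : E = (EuclideanSpace.equiv (Fin N) ℝ) ⁻¹' (Set.pi univ fun i => Ioo 0 (c i)) := by
    ext x; simp [hE, Set.mem_pi]
  have hEo : IsOpen E := by
    rw [hEpre]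
    exact (isOpen_set_pi finite_univ fun i _ => isOpen_Ioo).preimage (ContinuousLinearEquiv.continuous _)
  have hEb : Bornology.IsBounded E := by
    have hK : IsCompact ((EuclideanSpace.equiv (Fin N) ℝ).symm '' (Set.pi univ fun i => Icc 0 (c i))) :=
      (isCompact_univ_pi fun i => isCompact_Icc).image (ContinuousLinearEquiv.continuous _)
    refine hK.isBounded.subset ?_
    intro x hx
    refine ⟨EuclideanSpace.equiv (Fin N) ℝ x, ?_, by simp⟩
    intro i _
    exact Ioo_subset_Icc_self (hx i)
  have hEU : E ⊆ halfSpace N hN := fun x hx => (hx ⟨0, hN⟩).1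
  have hf : (frontier (halfSpace N hN)).Nonempty := hrH_frontier N hN
  have hc1 : Eᶜ.Nonempty := by
    refine ⟨0, fun h => ?_⟩
    have := (h ⟨0, hN⟩).1
    simp at this
  refine hr_b N hN _ (hrH_open N hN) hf E hEo hEb hEU (2 + 2 * n * δ) 1 δ (by positivity) one_pos hδ0
    ?_ ?_ L ?_
  · apply Eventually.frequently
    have hmin : 0 < min (δ / 2) (1 / 2) := by positivity
    filter_upwards [Ioo_mem_nhdsGT hmin] with t ht
    have ht0 : 0 < t := ht.1
    have htδ : t < δ / 2 := ht.2.trans_le (min_le_left _ _)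
    have ht1 : t < 1 / 2 := ht.2.trans_le (min_le_right _ _)
    set B : Set (EuclideanSpace ℝ (Fin N)) := {x | ∀ i, x i ∈ Ioo t (c i - t)} with hB
    have hBE : B ⊆ E := fun x hx i => ⟨ht0.trans (hx i).1, by linarith [(hx i).2]⟩
    have hBm : MeasurableSet B := by
      have : B = (EuclideanSpace.equiv (Fin N) ℝ) ⁻¹' (Set.pi univ fun i => Ioo t (c i - t)) := by
        ext x; simp [hB, Set.mem_pi]
      rw [this]
      exact ((isOpen_set_pi finite_univ fun i _ => isOpen_Ioo).preimage
        (ContinuousLinearEquiv.continuous _)).measurableSet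
    have hsub : {x | x ∈ E ∧ infDist x Eᶜ < t} ⊆ E \ B := by
      rintro x ⟨hx, hxt⟩
      refine ⟨hx, fun hxB => ?_⟩
      obtain ⟨y, hy, hyt⟩ := (infDist_lt_iff hc1).1 hxt
      apply hy
      intro i
      have h1 : |x i - y i| < t := by
        refine lt_of_le_of_lt ?_ hyt
        rw [dist_eq_norm]
        have := PiLp.norm_apply_le (x - y) i
        simpa using this
      rw [abs_lt] at h1
      have := hxB i
      exact ⟨by linarith [this.1], by linarith [this.2]⟩
    have hvE : volume E = ENNReal.ofReal δ := by
      rw [hE, hr_box_vol, ← ENNReal.ofReal_prod_of_nonneg]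
      · simp only [sub_zero, hc]
        rw [hr_box_prod]; simp
      · intro i _; simp only [hc]; split_ifs <;> simp [hδ0.le]
    have hvB : volume B = ENNReal.ofReal ((δ - 2 * t) * (1 - 2 * t) ^ n) := by
      rw [hB, hr_box_vol, ← ENNReal.ofReal_prod_of_nonneg]
      · congr 1
        rw [hn, ← hr_box_prod hN]
        refine Finset.prod_congr rfl fun i _ => ?_
        simp only [hc]; split_ifs <;> ring
      · intro i _; simp only [hc]; split_ifs <;> linarith
    have hp1 : 0 ≤ (δ - 2 * t) * (1 - 2 * t) ^ n :=
      mul_nonneg (by linarith) (pow_nonneg (by linarith) _)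
    calc _ ≤ volume (E \ B) := measure_mono hsub
      _ = volume E - volume B := measure_sdiff hBE hBm.nullMeasurableSet (by rw [hvB]; simp)
      _ = ENNReal.ofReal (δ - (δ - 2 * t) * (1 - 2 * t) ^ n) := by
          rw [hvE, hvB, ENNReal.ofReal_sub _ hp1]
      _ ≤ _ := by
          apply ENNReal.ofReal_le_ofReal
          have hb := one_add_mul_le_pow (a := -(2 * t)) (by linarith) n
          have e : 1 + -(2 * t) = 1 - 2 * t := by ring
          rw [e] at hb
          have h2 := mul_le_mul_of_nonneg_left hb (show 0 ≤ δ - 2 * t by linarith)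
          have h3 : 0 ≤ (n : ℝ) * t * t := by positivity
          nlinarith
  · intro t ht
    have hsub : {x : EuclideanSpace ℝ (Fin N) | ∀ i, x i ∈ Ioo ((fun _ => (0 : ℝ)) i)
        ((fun i => if i = ⟨0, hN⟩ then t else 1) i)} ⊆
        {x | x ∈ E ∧ infDist x (frontier (halfSpace N hN)) < t} := by
      intro x hx
      have hxE : x ∈ E := by
        intro i
        have := hx i
        refine ⟨this.1, this.2.trans_le ?_⟩
        simp only [hc]
        split_ifs
        · exact ht.2
        · exact le_rfl
      refine ⟨hxE, ?_⟩
      rw [hrH_dist N hN x (hEU hxE)]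
      simpa using (hx ⟨0, hN⟩).2
    refine le_trans (le_of_eq ?_) (measure_mono hsub)
    rw [hr_box_vol, ← ENNReal.ofReal_prod_of_nonneg]
    · simp only [sub_zero]
      rw [hr_box_prod]; simp
    · intro i _; simp only [sub_zero]; split_ifs <;> simp [ht.1.le]
  · have h4 : (4 * (n + 1)) * δ = L - 4 := by rw [hδ]; field_simp
    linarith

lemma hr_L2' (N : ℕ) (hN : 0 < N) (s η : ℝ) (hs0 : 0 < s) (hs1 : s < 1) (hη : 0 < η) :
    ∀ᶠ p in nhdsWithin (1 : ℝ) (Ioi 1),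
      ENNReal.ofReal (4 - η) * hrK N hN (s * p) ≤ hardyConst N s p (halfSpace N hN) := by
  set ε : ℝ := (η / 8) ^ (1 / (1 - s)) with hε
  have hε0 : 0 < ε := by positivity
  have h1s : 1 - s ≠ 0 := by linarith
  have hεs : ε ^ (1 - s) = η / 8 := by
    rw [hε, ← Real.rpow_mul (by positivity), one_div, inv_mul_cancel₀ h1s, Real.rpow_one]
  have hcont : ContinuousAt (fun p : ℝ =>
      2 * (2 - ε ^ (1 - s * p) - ε ^ (-(s * p)) * (1 - (2 : ℝ) ^ (1 - p)))) 1 := by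
    have c1 : ContinuousAt (fun p : ℝ => ε ^ (1 - s * p)) 1 :=
      ContinuousAt.rpow (by fun_prop) (by fun_prop) (Or.inl hε0.ne')
    have c2 : ContinuousAt (fun p : ℝ => ε ^ (-(s * p))) 1 :=
      ContinuousAt.rpow (by fun_prop) (by fun_prop) (Or.inl hε0.ne')
    have c3 : ContinuousAt (fun p : ℝ => (2 : ℝ) ^ (1 - p)) 1 :=
      ContinuousAt.rpow (by fun_prop) (by fun_prop) (Or.inl two_ne_zero)
    fun_prop
  have hev1 : ∀ᶠ p in nhds (1 : ℝ),
      4 - η < 2 * (2 - ε ^ (1 - s * p) - ε ^ (-(s * p)) * (1 - (2 : ℝ) ^ (1 - p))) := by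
    apply hcont.eventually_const_lt
    simp only [mul_one, hεs, sub_self, Real.rpow_zero, mul_zero]
    linarith
  have hev2 : ∀ᶠ p in nhds (1 : ℝ), s * p < 1 :=
    Tendsto.eventually_lt_const (v := s * 1) (by simpa using hs1)
      ((by fun_prop : Continuous fun p : ℝ => s * p).tendsto 1)
  have hev3 : ∀ᶠ p in nhdsWithin (1 : ℝ) (Ioi 1), 1 < p := eventually_mem_nhdsWithin
  filter_upwards [hev1.filter_mono nhdsWithin_le_nhds, hev2.filter_mono nhdsWithin_le_nhds, hev3]
    with p h1 h2 h3
  refine le_trans ?_ (hr_L2 N hN s p ε h3.le hε0 (by positivity) h2)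
  gcongr

lemma hr_ratio (N : ℕ) (hN : 0 < N) (Ω : Set (EuclideanSpace ℝ (Fin N))) (hne : Ω.Nonempty)
    (hop : IsOpen Ω) (hconv : Convex ℝ Ω) (hbd : Bornology.IsBounded Ω) (η : ℝ) (hη : 0 < η) (hη4 : η < 4) :
    ∀ᶠ s in nhdsWithin (1 : ℝ) (Iio 1), ∀ᶠ p in nhdsWithin (1 : ℝ) (Ioi 1),
      ENNReal.ofReal (2 / (4 + η)) ≤ hardyConst N s p Ω / hardyConst N s p (halfSpace N hN) ∧
      hardyConst N s p Ω / hardyConst N s p (halfSpace N hN) ≤ ENNReal.ofReal ((2 + η) / (4 - η)) := by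
  have hc : Ωᶜ.Nonempty := by
    obtain ⟨R, hR, hRb⟩ := hbd.subset_ball_lt 0 0
    refine ⟨R • hrE N hN, fun h => ?_⟩
    have := hRb h
    rw [mem_ball_zero_iff, norm_smul, hrE_norm, Real.norm_of_nonneg hR.le] at this
    linarith
  have hf : (frontier Ω).Nonempty := by
    rw [nonempty_frontier_iff]
    exact ⟨hne, nonempty_compl.1 hc⟩
  obtain ⟨σ1, hσ1, H1⟩ := hr_omega N hN Ω hne hop hconv hbd hf hc (2 + η) (by linarith)
  obtain ⟨σ2, hσ2, H2⟩ := hr_half N hN (4 + η) (by linarith)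
  have hm : max (max σ1 σ2) 0 < 1 := max_lt (max_lt hσ1 hσ2) one_pos
  filter_upwards [Ioo_mem_nhdsLT hm] with s hs
  have hsσ1 : σ1 < s := ((le_max_left _ _).trans (le_max_left _ _)).trans_lt hs.1
  have hsσ2 : σ2 < s := ((le_max_right _ _).trans (le_max_left _ _)).trans_lt hs.1
  have hs0 : 0 < s := (le_max_right _ _).trans_lt hs.1
  have hev2 : ∀ᶠ p in nhds (1 : ℝ), s * p < 1 :=
    Tendsto.eventually_lt_const (v := s * 1) (by simpa using hs.2)
      ((by fun_prop : Continuous fun p : ℝ => s * p).tendsto 1)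
  have hev3 : ∀ᶠ p in nhdsWithin (1 : ℝ) (Ioi 1), 1 < p := eventually_mem_nhdsWithin
  filter_upwards [hr_L2' N hN s η hs0 hs.2 hη, hev2.filter_mono nhdsWithin_le_nhds, hev3] with p h1 h2 h3
  have hsp : s < s * p := by nlinarith
  have hk := hrK_pos N hN (s * p)
  have hkf := hrK_fin N hN (s * p) (by positivity)
  have a1 := hr_L1 N hN s p Ω hop hconv hf
  have a2 := H1 s p h3.le (by linarith) h2
  have a3 := H2 s p h3.le (by linarith) h2
  set k := hrK N hN (s * p)
  have hdiv : ∀ a b : ℝ, 0 ≤ a → 0 < b → ENNReal.ofReal a * k / (ENNReal.ofReal b * k) = ENNReal.ofReal (a / b) := by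
    intro a b ha hb
    rw [ENNReal.mul_div_mul_right _ _ hk.ne' hkf.ne, ENNReal.ofReal_div_of_pos hb]
  constructor
  · rw [← hdiv 2 (4 + η) (by norm_num) (by linarith)]
    apply ENNReal.div_le_div _ a3
    simpa using a1
  · rw [← hdiv (2 + η) (4 - η) (by linarith) (by linarith)]
    exact ENNReal.div_le_div a2 h1

/-- for `N ≥ 1` and `Ω ⊊ ℝ^N` nonempty bounded convex open,
`lim_{s→1⁻} limsup_{p→1⁺} 𝔥_{s,p}(Ω)/𝔥_{s,p}(ℍ^N₊) = 1/2`. -/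
theorem hardy_ratio_iterated_limit (N : ℕ) (hN : 0 < N)
    (Ω : Set (EuclideanSpace ℝ (Fin N))) (hne : Ω.Nonempty) (hop : IsOpen Ω)
    (hconv : Convex ℝ Ω) (hbd : Bornology.IsBounded Ω) :
    Filter.Tendsto
      (fun s : ℝ => Filter.limsup
        (fun p : ℝ => hardyConst N s p Ω / hardyConst N s p (halfSpace N hN))
        (nhdsWithin 1 (Set.Ioi 1)))
      (nhdsWithin 1 (Set.Iio 1)) (nhds (1 / 2 : ℝ≥0∞)) := by
  have hev : ∀ᶠ η in nhdsWithin (0 : ℝ) (Ioi 0), 0 < η ∧ η < 4 :=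
    (Ioo_mem_nhdsGT (by norm_num : (0 : ℝ) < 4) : Ioo (0 : ℝ) 4 ∈ _)
  have hhalf : ENNReal.ofReal (1 / 2) = 1 / 2 := by
    rw [ENNReal.ofReal_div_of_pos two_pos]; simp
  rw [tendsto_order]
  constructor
  · intro a ha
    have hcont : ContinuousAt (fun η : ℝ => ENNReal.ofReal (2 / (4 + η))) 0 :=
      ENNReal.continuous_ofReal.continuousAt.comp
        (ContinuousAt.div (by fun_prop) (by fun_prop) (by norm_num))
    have h2 : ∀ᶠ η in nhds (0 : ℝ), a < ENNReal.ofReal (2 / (4 + η)) := by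
      apply hcont.eventually_const_lt
      have : (2 : ℝ) / (4 + 0) = 1 / 2 := by norm_num
      simp only [this, hhalf]; exact ha
    obtain ⟨η, ⟨h0, h4⟩, hη⟩ := (hev.and (h2.filter_mono nhdsWithin_le_nhds)).exists
    filter_upwards [hr_ratio N hN Ω hne hop hconv hbd η h0 h4] with s hs
    refine hη.trans_le ?_
    exact le_limsup_of_frequently_le' (hs.mono fun p hp => hp.1).frequently
  · intro a ha
    have hcont : ContinuousAt (fun η : ℝ => ENNReal.ofReal ((2 + η) / (4 - η))) 0 :=
      ENNReal.continuous_ofReal.continuousAt.comp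
        (ContinuousAt.div (by fun_prop) (by fun_prop) (by norm_num))
    have h2 : ∀ᶠ η in nhds (0 : ℝ), ENNReal.ofReal ((2 + η) / (4 - η)) < a := by
      apply hcont.eventually_lt_const
      have : ((2 : ℝ) + 0) / (4 - 0) = 1 / 2 := by norm_num
      simp only [this, hhalf]; exact ha
    obtain ⟨η, ⟨h0, h4⟩, hη⟩ := (hev.and (h2.filter_mono nhdsWithin_le_nhds)).exists
    filter_upwards [hr_ratio N hN Ω hne hop hconv hbd η h0 h4] with s hs
    refine lt_of_le_of_lt ?_ hη
    exact limsup_le_of_le (by isBoundedDefault) (hs.mono fun p hp => hp.2)
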